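/- Let γ ≥ 1/2 be a real number, let n ≥ 1, and let V : ℝ → M_n(ℂ) be a continuous function whose values are Hermitian nonpositive matrices, such that x ↦ tr((−V(x))^{γ+1/2}) is Lebesgue integrable on ℝ. Let ψ_1, …, ψ_N : ℝ → ℂ^n be twice continuously differentiable, square-integrable functions forming an orthonormal family in L²(ℝ, ℂ^n), and let E_1, …, E_N > 0 satisfy −ψ_j″ + Vψ_j = −E_j ψ_j on ℝ for each j. Then ∑_{j=1}^N E_j^γ ≤ 2 L^cl_{γ,1} ∫_ℝ tr((−V(x))^{γ+1/2}) dx, where L^cl_{γ,1} := Γ(γ+1)/(2 π^{1/2} Γ(γ + 3/2)). -/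

import Mathlib

open MeasureTheory Matrix
open scoped ComplexOrder

/-- The classical Lieb–Thirring constant `L^cl_{γ,d} = Γ(γ+1)/(2^d π^{d/2} Γ(γ+d/2+1))`. -/
noncomputable def Lcl (γ : ℝ) (d : ℕ) : ℝ :=
  Real.Gamma (γ + 1) / (2 ^ d * Real.pi ^ ((d : ℝ) / 2) * Real.Gamma (γ + d / 2 + 1))

/-- For a Hermitian matrix `A` (whose eigenvalues are nonnegative in our applications)
this is the trace of the power `A^p` defined by the functional calculus:
`tr(A^p) = ∑ λ_i(A)^p`. -/
noncomputable def traceRpow {n : ℕ} (A : Matrix (Fin n) (Fin n) ℂ)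
    (hA : A.IsHermitian) (p : ℝ) : ℝ :=
  ∑ i, hA.eigenvalues i ^ p

open Complex in
lemma integrable_exp_neg_mul_abs {a : ℝ} (ha : 0 < a) :
    Integrable fun x : ℝ => (Real.exp (-a * |x|) : ℂ) := by
  refine Integrable.ofReal (𝕜 := ℂ) (f := fun x : ℝ => Real.exp (-a * |x|)) ?_
  rw [← integrableOn_univ, ← Set.Iic_union_Ioi (a := (0 : ℝ))]
  refine IntegrableOn.union
    ((integrableOn_exp_mul_Iic ha 0).congr_fun (fun x hx => ?_) measurableSet_Iic)
    ((integrableOn_exp_mul_Ioi (neg_neg_of_pos ha) 0).congr_fun (fun x hx => ?_) measurableSet_Ioi)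
  · simp only [Set.mem_Iic] at hx
    simp [abs_of_nonpos hx]
  · simp only [Set.mem_Ioi] at hx
    simp [abs_of_pos hx]

open Complex FourierTransform in
lemma fourier_exp_neg_mul_abs {a : ℝ} (ha : 0 < a) (w : ℝ) :
    𝓕 (fun x : ℝ => (Real.exp (-a * |x|) : ℂ)) w =
      ((2 * a / (a ^ 2 + (2 * Real.pi * w) ^ 2) : ℝ) : ℂ) := by
  rw [Real.fourier_real_eq_integral_exp_smul]
  have h1 : 0 < ((a : ℂ) + ((-2 * Real.pi * w : ℝ) : ℂ) * I).re := by simpa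
  have h2 : (-(a : ℂ) + ((-2 * Real.pi * w : ℝ) : ℂ) * I).re < 0 := by simpa
  have e1 : Set.EqOn (fun v : ℝ => cexp (↑(-2 * Real.pi * v * w) * I) • ((Real.exp (-a * |v|) : ℝ) : ℂ))
      (fun v : ℝ => cexp (((a : ℂ) + ((-2 * Real.pi * w : ℝ) : ℂ) * I) * v)) (Set.Iic 0) := by
    intro v hv
    simp only [Set.mem_Iic] at hv
    simp only [abs_of_nonpos hv, smul_eq_mul, ofReal_exp, ← Complex.exp_add]
    congr 1; push_cast; ring
  have e2 : Set.EqOn (fun v : ℝ => cexp (↑(-2 * Real.pi * v * w) * I) • ((Real.exp (-a * |v|) : ℝ) : ℂ))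
      (fun v : ℝ => cexp ((-(a : ℂ) + ((-2 * Real.pi * w : ℝ) : ℂ) * I) * v)) (Set.Ioi 0) := by
    intro v hv
    simp only [Set.mem_Ioi] at hv
    simp only [abs_of_pos hv, smul_eq_mul, ofReal_exp, ← Complex.exp_add]
    congr 1; push_cast; ring
  rw [← setIntegral_univ, ← Set.Iic_union_Ioi (a := (0 : ℝ)),
    setIntegral_union (Set.Iic_disjoint_Ioi le_rfl) measurableSet_Ioi
      ((integrableOn_exp_mul_complex_Iic h1 0).congr_fun e1.symm measurableSet_Iic)
      ((integrableOn_exp_mul_complex_Ioi h2 0).congr_fun e2.symm measurableSet_Ioi),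
    setIntegral_congr_fun measurableSet_Iic e1, setIntegral_congr_fun measurableSet_Ioi e2,
    integral_exp_mul_complex_Iic h1, integral_exp_mul_complex_Ioi h2]
  have n1 : (a : ℂ) + ((-2 * Real.pi * w : ℝ) : ℂ) * I ≠ 0 := fun h => by rw [h] at h1; simp at h1
  have n2 : -(a : ℂ) + ((-2 * Real.pi * w : ℝ) : ℂ) * I ≠ 0 := fun h => by rw [h] at h2; simp at h2
  have n3 : (a : ℂ) ^ 2 + (2 * Real.pi * w) ^ 2 ≠ 0 := by
    have : a ^ 2 + (2 * Real.pi * w) ^ 2 ≠ 0 := by positivity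
    exact_mod_cast this
  push_cast at n1 n2 n3 ⊢
  rw [mul_zero, mul_zero, Complex.exp_zero, div_add_div _ _ n1 n2, div_eq_div_iff (mul_ne_zero n1 n2) n3]
  linear_combination (-2 * a * (2 * Real.pi * w) ^ 2) * I_sq

open Complex FourierTransform in
/-- The function `exp (-a |t|)` is the characteristic function of a (Cauchy) distribution. -/
lemma exists_measure_integral_cexp_eq {a : ℝ} (ha : 0 ≤ a) :
    ∃ μ : Measure ℝ, IsProbabilityMeasure μ ∧ ∀ t : ℝ,
      ∫ p : ℝ, cexp (((2 * Real.pi * (p * t) : ℝ) : ℂ) * I) ∂μ = (Real.exp (-a * |t|) : ℂ) := by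
  rcases ha.eq_or_lt with rfl | ha
  · exact ⟨Measure.dirac 0, inferInstance, fun t => by simp⟩
  set f : ℝ → ℂ := fun x => (Real.exp (-a * |x|) : ℂ) with hf
  set g : ℝ → ℝ := fun w => 2 * a / (a ^ 2 + (2 * Real.pi * w) ^ 2) with hg
  have hg0 : ∀ w, 0 ≤ g w := fun w => by positivity
  have hgi : Integrable g := by
    have := (integrable_inv_one_add_sq.comp_mul_left' (R := 2 * Real.pi / a) (by positivity)).const_mul (2 / a)
    refine this.congr (.of_forall fun w => ?_)
    simp only [hg]
    field_simp
  have hFf : 𝓕 f = fun w => (g w : ℂ) := funext (fourier_exp_neg_mul_abs ha)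
  have hinv : ∀ t : ℝ, ∫ p : ℝ, cexp (((2 * Real.pi * (p * t) : ℝ) : ℂ) * I) * (g p : ℂ) = f t := by
    intro t
    have h := congrFun (Continuous.fourierInv_fourier_eq (f := f) (by fun_prop)
      (integrable_exp_neg_mul_abs ha) (by rw [hFf]; exact hgi.ofReal)) t
    rw [hFf, Real.fourierInv_eq'] at h
    rw [← h]
    refine integral_congr_ae (.of_forall fun p => ?_)
    simp [mul_comm t]
  have hone : ∫ p, g p = 1 := by
    have := hinv 0
    simp only [mul_zero, ofReal_zero, zero_mul, Complex.exp_zero, one_mul, hf, abs_zero, Real.exp_zero] at this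
    rw [integral_complex_ofReal] at this
    exact_mod_cast this
  refine ⟨volume.withDensity fun p => ENNReal.ofReal (g p), ⟨?_⟩, fun t => ?_⟩
  · rw [withDensity_apply _ MeasurableSet.univ, Measure.restrict_univ,
      ← ofReal_integral_eq_lintegral_ofReal hgi (.of_forall hg0), hone, ENNReal.ofReal_one]
  · rw [integral_withDensity_eq_integral_toReal_smul (by fun_prop) (by simp)]
    refine Eq.trans (integral_congr_ae (.of_forall fun p => ?_)) (hinv t)
    simp [ENNReal.toReal_ofReal (hg0 p), mul_comm]

open Complex in
/-- The quadratic form with kernel `exp (-κ |x - y|)`. -/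
noncomputable def expForm (κ : ℝ) (h : ℝ → ℂ) : ℂ :=
  ∫ z : ℝ × ℝ, (Real.exp (-κ * |z.2 - z.1|) : ℂ) * ((starRingEnd ℂ) (h z.1) * h z.2)

/-- The unitary phase `x ↦ exp (2 π i p x)`. -/
noncomputable def phase (p x : ℝ) : ℂ := Complex.exp (((2 * Real.pi * (p * x) : ℝ) : ℂ) * Complex.I)

lemma continuous_phase : Continuous fun z : ℝ × ℝ => phase z.1 z.2 := by
  unfold phase; fun_prop

lemma norm_phase (p x : ℝ) : ‖phase p x‖ = 1 := Complex.norm_exp_ofReal_mul_I _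

lemma conj_phase_mul_phase (p x y : ℝ) :
    (starRingEnd ℂ) (phase p x) * phase p y = phase p (y - x) := by
  unfold phase
  rw [← Complex.exp_conj, ← Complex.exp_add]
  congr 1
  simp only [map_mul, Complex.conj_ofReal, Complex.conj_I]
  push_cast; ring

lemma expForm_zero (h : ℝ → ℂ) : (expForm 0 h).re = ‖∫ x, h x‖ ^ 2 := by
  unfold expForm
  simp only [neg_zero, zero_mul, Real.exp_zero, Complex.ofReal_one, one_mul]
  rw [Measure.volume_eq_prod, integral_prod_mul (fun x => (starRingEnd ℂ) (h x)) h, integral_conj,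
    Complex.conj_mul']
  norm_cast

/-- Passing from `κ` to the larger parameter `κ + δ` amounts to averaging over phases. -/
lemma integral_expForm_phase {κ δ : ℝ} (hκ : 0 ≤ κ) {μ : Measure ℝ} [IsProbabilityMeasure μ]
    (hμ : ∀ t : ℝ, ∫ p : ℝ, phase p t ∂μ = (Real.exp (-δ * |t|) : ℂ))
    {h : ℝ → ℂ} (hh : Integrable h) :
    Integrable (fun p => expForm κ fun x => phase p x * h x) μ ∧
      ∫ p, expForm κ (fun x => phase p x * h x) ∂μ = expForm (κ + δ) h := by
  set G : ℝ × ℝ → ℂ := fun z =>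
    (Real.exp (-κ * |z.2 - z.1|) : ℂ) * ((starRingEnd ℂ) (h z.1) * h z.2) with hG
  have hprod : Integrable fun z : ℝ × ℝ => (starRingEnd ℂ) (h z.1) * h z.2 := by
    rw [Measure.volume_eq_prod]
    exact Integrable.mul_prod (LinearIsometryEquiv.integrable_comp_iff Complex.conjLIE |>.2 hh) hh
  have hGi : Integrable G := by
    refine hprod.bdd_mul (c := 1) (by fun_prop) (.of_forall fun z => ?_)
    rw [Complex.norm_real, Real.norm_of_nonneg (Real.exp_nonneg _), Real.exp_le_one_iff]
    nlinarith [abs_nonneg (z.2 - z.1)]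
  have hF : Integrable (fun w : ℝ × (ℝ × ℝ) => phase w.1 (w.2.2 - w.2.1) * G w.2)
      (μ.prod volume) := by
    refine (hGi.comp_snd μ).bdd_mul (c := 1) ?_ (.of_forall fun w => (norm_phase _ _).le)
    exact (continuous_phase.comp (by fun_prop : Continuous fun w : ℝ × (ℝ × ℝ) =>
      (w.1, w.2.2 - w.2.1))).aestronglyMeasurable
  have key : ∀ p, expForm κ (fun x => phase p x * h x)
      = ∫ z : ℝ × ℝ, phase p (z.2 - z.1) * G z := by
    intro p
    refine integral_congr_ae (.of_forall fun z => ?_)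
    simp only [hG, ← conj_phase_mul_phase, map_mul]
    ring
  simp only [key]
  refine ⟨hF.integral_prod_left, ?_⟩
  rw [integral_integral_swap hF]
  refine integral_congr_ae (.of_forall fun z => ?_)
  simp only
  rw [integral_mul_const, hμ]
  simp only [hG, ← mul_assoc]
  congr 2
  rw [← Complex.ofReal_mul, ← Real.exp_add]
  congr 2; ring

/-- The integral kernel of the inverse of `-d/dz + κ`, with arguments `(z, x)` in the order `x z`. -/
noncomputable def expKernel (κ x z : ℝ) : ℝ := (Set.Iic x).indicator (fun z => Real.exp (-κ * (x - z))) z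

lemma expKernel_nonneg (κ x z : ℝ) : 0 ≤ expKernel κ x z :=
  Set.indicator_nonneg (fun _ _ => Real.exp_nonneg _) _

lemma measurable_expKernel (κ : ℝ) : Measurable fun w : ℝ × ℝ => expKernel κ w.1 w.2 := by
  have : (fun w : ℝ × ℝ => expKernel κ w.1 w.2)
      = {w : ℝ × ℝ | w.2 ≤ w.1}.indicator fun w => Real.exp (-κ * (w.1 - w.2)) := by
    ext w
    by_cases h : w.2 ≤ w.1 <;> simp [expKernel, h]
  rw [this]
  exact Measurable.indicator (by fun_prop) (measurableSet_le measurable_snd measurable_fst)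

lemma expKernel_mul_expKernel (κ x y z : ℝ) : expKernel κ x z * expKernel κ y z =
    (Set.Iic (min x y)).indicator
      (fun z => Real.exp (-κ * (x + y)) * Real.exp (2 * κ * z)) z := by
  unfold expKernel
  rw [← Set.Iic_inter_Iic]
  refine (Set.inter_indicator_mul _ _ _).symm.trans ?_
  congr 1
  ext z
  rw [← Real.exp_add, ← Real.exp_add]
  congr 1; ring

lemma integrable_expKernel_mul {κ : ℝ} (hκ : 0 < κ) (x y : ℝ) :
    Integrable fun z => expKernel κ x z * expKernel κ y z := by
  simp only [expKernel_mul_expKernel]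
  rw [integrable_indicator_iff measurableSet_Iic]
  exact (integrableOn_exp_mul_Iic (by positivity) _).const_mul _

lemma integral_expKernel_mul {κ : ℝ} (hκ : 0 < κ) (x y : ℝ) :
    ∫ z, expKernel κ x z * expKernel κ y z = Real.exp (-κ * |y - x|) / (2 * κ) := by
  simp only [expKernel_mul_expKernel]
  rw [integral_indicator measurableSet_Iic, integral_const_mul,
    integral_exp_mul_Iic (by positivity), mul_div_assoc', ← Real.exp_add]
  congr 2
  rcases le_total x y with h | h
  · rw [min_eq_left h, abs_of_nonneg (sub_nonneg.2 h)]; ring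
  · rw [min_eq_right h, abs_of_nonpos (sub_nonpos.2 h)]; ring

/-- The solution `g` of `-g' + κ g = h` decaying at infinity. -/
noncomputable def expPotential (κ : ℝ) (h : ℝ → ℂ) (z : ℝ) : ℂ := ∫ x, (expKernel κ x z : ℂ) * h x

lemma integral_norm_sq_expPotential {κ : ℝ} (hκ : 0 < κ) {h : ℝ → ℂ} (hh : Integrable h) :
    (Integrable fun z => ‖expPotential κ h z‖ ^ 2) ∧
      2 * κ * ∫ z, ‖expPotential κ h z‖ ^ 2 = (expForm κ h).re := by
  have hprod : Integrable fun z : ℝ × ℝ => (starRingEnd ℂ) (h z.1) * h z.2 := by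
    rw [Measure.volume_eq_prod]
    exact Integrable.mul_prod (LinearIsometryEquiv.integrable_comp_iff Complex.conjLIE |>.2 hh) hh
  set G : (ℝ × ℝ) × ℝ → ℂ := fun w => ((expKernel κ w.1.1 w.2 * expKernel κ w.1.2 w.2 : ℝ) : ℂ) *
    ((starRingEnd ℂ) (h w.1.1) * h w.1.2) with hG
  have hmk : Measurable fun w : (ℝ × ℝ) × ℝ => expKernel κ w.1.1 w.2 * expKernel κ w.1.2 w.2 :=
    ((measurable_expKernel κ).comp (by fun_prop : Measurable fun w : (ℝ × ℝ) × ℝ => (w.1.1, w.2))).mul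
      ((measurable_expKernel κ).comp (by fun_prop : Measurable fun w : (ℝ × ℝ) × ℝ => (w.1.2, w.2)))
  have hGm : AEStronglyMeasurable G (volume.prod volume) :=
    (Complex.measurable_ofReal.comp hmk).aestronglyMeasurable.mul hprod.1.comp_fst
  have hGi : Integrable G (volume.prod volume) := by
    rw [integrable_prod_iff hGm]
    refine ⟨.of_forall fun w => ?_, ?_⟩
    · simp only [hG]
      exact (integrable_expKernel_mul hκ w.1 w.2).ofReal.mul_const _
    have : ∀ w : ℝ × ℝ, ∫ z, ‖G (w, z)‖ =
        Real.exp (-κ * |w.2 - w.1|) / (2 * κ) * ‖(starRingEnd ℂ) (h w.1) * h w.2‖ := by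
      intro w
      simp only [hG, norm_mul, Complex.norm_real, Real.norm_of_nonneg (expKernel_nonneg _ _ _)]
      rw [integral_mul_const, integral_expKernel_mul hκ]
    simp only [this]
    refine hprod.norm.bdd_mul (c := 1 / (2 * κ)) (by fun_prop) (.of_forall fun z => ?_)
    rw [Real.norm_of_nonneg (by positivity)]
    gcongr
    rw [Real.exp_le_one_iff]
    nlinarith [abs_nonneg (z.2 - z.1)]
  have key : ∀ z, ∫ w, G (w, z) = ((‖expPotential κ h z‖ ^ 2 : ℝ) : ℂ) := by
    intro z
    have : ∀ w, G (w, z) = (fun x => (starRingEnd ℂ) ((expKernel κ x z : ℂ) * h x)) w.1 *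
        (fun x => (expKernel κ x z : ℂ) * h x) w.2 := by
      intro w
      simp only [hG, map_mul, Complex.conj_ofReal]
      push_cast; ring
    simp only [this]
    rw [Measure.volume_eq_prod, integral_prod_mul
      (fun x => (starRingEnd ℂ) ((expKernel κ x z : ℂ) * h x))
      (fun x => (expKernel κ x z : ℂ) * h x), integral_conj, Complex.conj_mul']
    norm_cast
  have h1 := hGi.integral_prod_right
  have h2 := integral_integral_swap (f := fun w z => G (w, z)) hGi
  simp only [key] at h1 h2
  refine ⟨by simpa only [RCLike.re_to_complex, Complex.ofReal_re] using h1.re, ?_⟩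
  have h3 : ∫ w : ℝ × ℝ, ∫ z, G (w, z) = expForm κ h / (2 * κ) := by
    unfold expForm
    rw [← integral_div]
    refine integral_congr_ae (.of_forall fun w => ?_)
    simp only [hG]
    rw [integral_mul_const, integral_complex_ofReal, integral_expKernel_mul hκ]
    push_cast; ring
  rw [h3, integral_complex_ofReal] at h2
  have h4 : expForm κ h = ((2 * κ * ∫ z, ‖expPotential κ h z‖ ^ 2 : ℝ) : ℂ) := by
    have : (κ : ℂ) ≠ 0 := by exact_mod_cast hκ.ne'
    push_cast
    rw [← h2]
    field_simp
  rw [h4, Complex.ofReal_re]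

lemma integral_expKernel_mul_deriv {κ : ℝ} (hκ : 0 < κ) {u u' : ℝ → ℂ}
    (hu : ∀ x, HasDerivAt u (u' x) x) {M : ℝ} (hM : ∀ x, ‖u x‖ ≤ M) {x : ℝ}
    (hi : Integrable fun z => (expKernel κ x z : ℂ) * (u' z + κ * u z)) :
    ∫ z, (expKernel κ x z : ℂ) * (u' z + κ * u z) = u x := by
  have e : (fun z => (expKernel κ x z : ℂ) * (u' z + κ * u z)) = (Set.Iic x).indicator
      fun z => (Real.exp (-κ * (x - z)) : ℂ) * (u' z + κ * u z) := by
    ext z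
    by_cases h : z ≤ x <;> simp [expKernel, h]
  rw [e] at hi ⊢
  rw [integrable_indicator_iff measurableSet_Iic] at hi
  rw [integral_indicator measurableSet_Iic,
    integral_Iic_of_hasDerivAt_of_tendsto' (f := fun z => (Real.exp (-κ * (x - z)) : ℂ) * u z)
      (m := 0) (fun z _ => ?_) hi ?_]
  · simp
  · refine squeeze_zero_norm (a := fun z => Real.exp (-κ * (x - z)) * M) (fun z => ?_) ?_
    · rw [norm_mul, Complex.norm_real, Real.norm_of_nonneg (Real.exp_nonneg _)]
      gcongr
      exact hM z
    · rw [← zero_mul M]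
      refine (Real.tendsto_exp_atBot.comp ?_).mul_const M
      have : Filter.Tendsto (fun z : ℝ => κ * z - κ * x) Filter.atBot Filter.atBot :=
        Filter.tendsto_atBot_add_const_right _ _ (Filter.tendsto_id.const_mul_atBot hκ)
      refine this.congr fun z => ?_
      ring
  · have h1 : HasDerivAt (fun z : ℝ => Real.exp (-κ * (x - z))) (Real.exp (-κ * (x - z)) * κ) z := by
      have := (((hasDerivAt_id z).const_sub x).const_mul (-κ)).exp
      simpa using this
    refine (h1.ofReal_comp.mul (hu z)).congr_deriv ?_
    push_cast; ring

lemma integral_conj_expPotential_mul {κ : ℝ} (hκ : 0 < κ) {h : ℝ → ℂ} (hh : Integrable h)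
    {u u' : ℝ → ℂ} (hu : ∀ x, HasDerivAt u (u' x) x) (hu'c : Continuous u')
    {M : ℝ} (hM : ∀ x, ‖u x‖ ≤ M) (hi : Integrable fun x => ‖u' x + κ * u x‖ ^ 2) :
    (Integrable fun z => (starRingEnd ℂ) (expPotential κ h z) * (u' z + κ * u z)) ∧
    ∫ z, (starRingEnd ℂ) (expPotential κ h z) * (u' z + κ * u z) =
      ∫ x, (starRingEnd ℂ) (h x) * u x := by
  have hh' : Integrable fun x => (starRingEnd ℂ) (h x) :=
    LinearIsometryEquiv.integrable_comp_iff Complex.conjLIE |>.2 hh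
  have huc : Continuous u := continuous_iff_continuousAt.2 fun x => (hu x).continuousAt
  have hac : Continuous fun z => u' z + κ * u z := by fun_prop
  have hKm : ∀ x, Measurable fun z => expKernel κ x z := fun x =>
    (measurable_expKernel κ).comp measurable_prodMk_left
  have hle : ∀ x z, ‖(expKernel κ x z : ℂ) * (u' z + κ * u z)‖ ≤
      expKernel κ x z * expKernel κ x z + ‖u' z + κ * u z‖ ^ 2 := by
    intro x z
    rw [norm_mul, Complex.norm_real, Real.norm_of_nonneg (expKernel_nonneg _ _ _)]
    nlinarith [sq_nonneg (expKernel κ x z - ‖u' z + κ * u z‖), mul_self_nonneg (expKernel κ x z),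
      sq_nonneg ‖u' z + κ * u z‖]
  have hKi : ∀ x, Integrable fun z => (expKernel κ x z : ℂ) * (u' z + κ * u z) := fun x =>
    ((integrable_expKernel_mul hκ x x).add hi).mono'
      ((Complex.measurable_ofReal.comp (hKm x)).aestronglyMeasurable.mul hac.aestronglyMeasurable)
      (.of_forall (hle x))
  set F : ℝ × ℝ → ℂ := fun w =>
    (starRingEnd ℂ) (h w.1) * ((expKernel κ w.1 w.2 : ℂ) * (u' w.2 + κ * u w.2)) with hF
  have hFm : AEStronglyMeasurable F (volume.prod volume) :=
    hh'.1.comp_fst.mul ((Complex.measurable_ofReal.comp (measurable_expKernel κ)).aestronglyMeasurable.mul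
      (hac.comp continuous_snd).aestronglyMeasurable)
  have hFi : Integrable F (volume.prod volume) := by
    rw [integrable_prod_iff hFm]
    refine ⟨.of_forall fun x => ?_, ?_⟩
    · simp only [hF]
      exact (hKi x).const_mul _
    refine (hh'.norm.mul_const (1 / (2 * κ) + ∫ z, ‖u' z + κ * u z‖ ^ 2)).mono'
      hFm.norm.integral_prod_right' (.of_forall fun x => ?_)
    rw [Real.norm_of_nonneg (integral_nonneg fun _ => norm_nonneg _)]
    simp only [hF, norm_mul _ ((expKernel κ _ _ : ℂ) * _)]
    rw [integral_const_mul]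
    gcongr
    have e := integral_expKernel_mul hκ x x
    simp only [sub_self, abs_zero, mul_zero, Real.exp_zero] at e
    rw [← e, ← integral_add (integrable_expKernel_mul hκ x x) hi]
    exact integral_mono (hKi x).norm ((integrable_expKernel_mul hκ x x).add hi) (hle x)
  have key : ∀ z, ∫ x, F (x, z) = (starRingEnd ℂ) (expPotential κ h z) * (u' z + κ * u z) := by
    intro z
    unfold expPotential
    rw [← integral_conj, ← integral_mul_const]
    refine integral_congr_ae (.of_forall fun x => ?_)
    simp only [hF, map_mul, Complex.conj_ofReal]
    ring
  have h1 := hFi.integral_prod_right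
  have h2 := integral_integral_swap (f := fun x z => F (x, z)) hFi
  simp only [key] at h1 h2
  refine ⟨h1, h2.symm.trans (integral_congr_ae (.of_forall fun x => ?_))⟩
  simp only [hF]
  rw [integral_const_mul, integral_expKernel_mul_deriv hκ hu hM (hKi x)]

lemma norm_add_sq_complex (a b : ℂ) : ‖a + b‖ ^ 2 = ‖a‖ ^ 2 + ‖b‖ ^ 2 + 2 * ((starRingEnd ℂ) a * b).re := by
  rw [← Complex.normSq_eq_norm_sq, ← Complex.normSq_eq_norm_sq, ← Complex.normSq_eq_norm_sq]
  simp only [Complex.normSq_apply, Complex.add_re, Complex.add_im, Complex.mul_re, Complex.conj_re, Complex.conj_im]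
  ring

lemma hasDerivAt_norm_sq_complex {u : ℝ → ℂ} {d : ℂ} {x : ℝ} (hu : HasDerivAt u d x) :
    HasDerivAt (fun x => ‖u x‖ ^ 2) (2 * ((starRingEnd ℂ) (u x) * d).re) x := by
  have := hu.norm_sq
  convert this using 1
  simp [Complex.inner]
  ring

lemma integrable_conj_mul {u v : ℝ → ℂ} (hu : Continuous u) (hv : Continuous v)
    (hui : Integrable fun x => ‖u x‖ ^ 2) (hvi : Integrable fun x => ‖v x‖ ^ 2) :
    Integrable fun x => (starRingEnd ℂ) (u x) * v x := by
  refine (hui.add hvi).mono' (by fun_prop) (.of_forall fun x => ?_)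
  rw [norm_mul, RCLike.norm_conj]
  simp only [Pi.add_apply]
  nlinarith [sq_nonneg (‖u x‖ - ‖v x‖), sq_nonneg ‖u x‖, sq_nonneg ‖v x‖]

lemma integral_norm_sq_deriv_add {κ : ℝ} {u u' : ℝ → ℂ}
    (hu : ∀ x, HasDerivAt u (u' x) x) (hu'c : Continuous u')
    (hui : Integrable fun x => ‖u x‖ ^ 2) (hu'i : Integrable fun x => ‖u' x‖ ^ 2) :
    (Integrable fun x => ‖u' x + κ * u x‖ ^ 2) ∧
      ∫ x, ‖u' x + κ * u x‖ ^ 2 = (∫ x, ‖u' x‖ ^ 2) + κ ^ 2 * ∫ x, ‖u x‖ ^ 2 := by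
  have huc : Continuous u := continuous_iff_continuousAt.2 fun x => (hu x).continuousAt
  have hc : Integrable fun x => 2 * ((starRingEnd ℂ) (u x) * u' x).re :=
    ((integrable_conj_mul huc hu'c hui hu'i).re).const_mul 2
  have h0 := integral_eq_zero_of_hasDerivAt_of_integrable
    (fun x => hasDerivAt_norm_sq_complex (hu x)) hc hui
  have e : ∀ x, ‖u' x + κ * u x‖ ^ 2 = ‖u' x‖ ^ 2 + κ ^ 2 * ‖u x‖ ^ 2 +
      κ * (2 * ((starRingEnd ℂ) (u x) * u' x).re) := by
    intro x
    rw [norm_add_sq_complex, norm_mul, Complex.norm_real, mul_pow, Real.norm_eq_abs, sq_abs]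
    simp only [Complex.mul_re, Complex.conj_re, Complex.conj_im, Complex.mul_im, Complex.ofReal_re,
      Complex.ofReal_im]
    ring
  simp only [e]
  have hs : Integrable fun x => ‖u' x‖ ^ 2 + κ ^ 2 * ‖u x‖ ^ 2 := hu'i.add (hui.const_mul _)
  refine ⟨hs.add (hc.const_mul _), ?_⟩
  rw [integral_add hs (hc.const_mul _),
    integral_add hu'i (hui.const_mul _), integral_const_mul, integral_const_mul κ, h0, mul_zero, add_zero]

/-- Variational lower bound for `expForm`: it is `2κ` times the quadratic form of
`(-d²/dx² + κ²)⁻¹`. -/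
lemma le_re_expForm {κ : ℝ} (hκ : 0 < κ) {h : ℝ → ℂ} (hh : Integrable h)
    {u u' : ℝ → ℂ} (hu : ∀ x, HasDerivAt u (u' x) x) (hu'c : Continuous u')
    {M : ℝ} (hM : ∀ x, ‖u x‖ ≤ M)
    (hui : Integrable fun x => ‖u x‖ ^ 2) (hu'i : Integrable fun x => ‖u' x‖ ^ 2) :
    2 * κ * (2 * (∫ x, (starRingEnd ℂ) (h x) * u x).re - ((∫ x, ‖u' x‖ ^ 2) + κ ^ 2 * ∫ x, ‖u x‖ ^ 2))
      ≤ (expForm κ h).re := by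
  obtain ⟨hai, ha⟩ := integral_norm_sq_deriv_add (κ := κ) hu hu'c hui hu'i
  obtain ⟨hgi, hg⟩ := integral_norm_sq_expPotential hκ hh
  obtain ⟨hci, hc⟩ := integral_conj_expPotential_mul hκ hh hu hu'c hM hai
  rw [← hg, ← hc, ← ha]
  gcongr
  have hre := integral_re hci
  simp only [RCLike.re_to_complex] at hre
  have hci' : Integrable fun z => ((starRingEnd ℂ) (expPotential κ h z) * (u' z + κ * u z)).re := hci.re
  rw [← hre, ← integral_const_mul, ← integral_sub (hci'.const_mul 2) hai]
  refine integral_mono ((hci'.const_mul 2).sub hai) hgi fun z => ?_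
  have := norm_add_sq_complex (expPotential κ h z) (-(u' z + κ * u z))
  rw [norm_neg, mul_neg, Complex.neg_re] at this
  nlinarith [sq_nonneg ‖expPotential κ h z + -(u' z + κ * u z)‖]

/-- `φ` is orthonormal on `s` with respect to the sesquilinear form `B`. -/
def OrthonormalOn {ι X : Type*} [DecidableEq ι] [AddCommGroup X] [Module ℂ X]
    (B : X →ₗ⋆[ℂ] X →ₗ[ℂ] ℂ) (s : Finset ι) (φ : ι → X) : Prop :=
  ∀ i ∈ s, ∀ j ∈ s, B (φ i) (φ j) = if i = j then 1 else 0

lemma exists_combination_orthogonal {ι X : Type*} [DecidableEq ι] [AddCommGroup X] [Module ℂ X]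
    (B : X →ₗ⋆[ℂ] X →ₗ[ℂ] ℂ) (ψ φ : ι → X) {s t : Finset ι} (hst : s.card < t.card) :
    ∃ c : ι → ℂ, (∃ i ∈ t, c i ≠ 0) ∧ ∀ i ∈ s, B (φ i) (∑ j ∈ t, c j • ψ j) = 0 := by
  let L : (t → ℂ) →ₗ[ℂ] (s → ℂ) :=
    LinearMap.pi fun i : s => (B (φ i)).comp (Fintype.linearCombination ℂ fun j : t => ψ j)
  have hker : LinearMap.ker L ≠ ⊥ := LinearMap.ker_ne_bot_of_finrank_lt (by simpa using hst)
  obtain ⟨c, hc, hc0⟩ := (Submodule.ne_bot_iff _).1 hker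
  obtain ⟨i, hi⟩ := Function.ne_iff.1 hc0
  refine ⟨fun j => if h : j ∈ t then c ⟨j, h⟩ else 0, ⟨i, i.2, by simpa using hi⟩, fun k hk => ?_⟩
  have hck := congrFun (LinearMap.mem_ker.1 hc) ⟨k, hk⟩
  rw [← Finset.sum_coe_sort]
  simpa [L, Fintype.linearCombination_apply] using hck

/-- Abstract monotonicity argument: `J k` is a family of forms such that the sums over orthonormal
families can be increased when decreasing `k`, and which is bounded below by `2 k` on the
span of the `ψ i` with `k ≤ κ i`. -/
lemma exists_orthonormalOn_sum_le {ι X : Type*} [DecidableEq ι] [AddCommGroup X] [Module ℂ X]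
    (B : X →ₗ⋆[ℂ] X →ₗ[ℂ] ℂ) (hB : ∀ x y, (starRingEnd ℂ) (B x y) = B y x)
    (J : ℝ → X → ℝ) (κ : ι → ℝ) (hκ : ∀ i, 0 < κ i) (ψ : ι → X)
    (hmono : ∀ k δ : ℝ, 0 ≤ k → 0 ≤ δ → ∀ (s : Finset ι) (φ : ι → X), OrthonormalOn B s φ →
      ∃ φ' : ι → X, OrthonormalOn B s φ' ∧ ∑ i ∈ s, J (k + δ) (φ i) ≤ ∑ i ∈ s, J k (φ' i))
    (hpos : ∀ (s : Finset ι) (c : ι → ℂ), (∃ i ∈ s, c i ≠ 0) →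
      0 < (B (∑ i ∈ s, c i • ψ i) (∑ i ∈ s, c i • ψ i)).re)
    (hlow : ∀ (s : Finset ι) (c : ι → ℂ) (k : ℝ), 0 < k → (∀ i ∈ s, k ≤ κ i) →
      2 * k * (B (∑ i ∈ s, c i • ψ i) (∑ i ∈ s, c i • ψ i)).re ≤ J k (∑ i ∈ s, c i • ψ i))
    (s : Finset ι) :
    ∀ k : ℝ, 0 ≤ k → (∀ i ∈ s, k ≤ κ i) →
      ∃ φ : ι → X, OrthonormalOn B s φ ∧ ∑ i ∈ s, 2 * κ i ≤ ∑ i ∈ s, J k (φ i) := by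
  induction s using Finset.induction_on_min_value κ with
  | empty => exact fun k _ _ => ⟨ψ, by simp [OrthonormalOn], by simp⟩
  | insert a s has hmin ih =>
    intro k hk hks
    obtain ⟨φ, hφ, hsum⟩ := ih (κ a) (hκ a).le hmin
    obtain ⟨c, hc, horth⟩ := exists_combination_orthogonal B ψ φ (s := s) (t := insert a s)
      (by simp [has])
    set Ψ := ∑ j ∈ insert a s, c j • ψ j with hΨ
    have hb := hpos _ c hc
    rw [← hΨ] at hb
    set b := (B Ψ Ψ).re with hbdef
    have hBb : B Ψ Ψ = (b : ℂ) := (Complex.conj_eq_iff_re.1 (hB Ψ Ψ)).symm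
    set r : ℂ := (((√b)⁻¹ : ℝ) : ℂ) with hr
    have hrr : B (r • Ψ) (r • Ψ) = 1 := by
      have : (√b)⁻¹ * ((√b)⁻¹ * b) = 1 := by
        have h1 := Real.mul_self_sqrt hb.le
        have h2 := (Real.sqrt_pos.2 hb).ne'
        field_simp
        nlinarith
      rw [map_smul, LinearMap.map_smulₛₗ, LinearMap.smul_apply, hBb, hr, Complex.conj_ofReal]
      simp only [smul_eq_mul]
      exact_mod_cast this
    have hrΨ : r • Ψ = ∑ j ∈ insert a s, (r * c j) • ψ j := by
      simp only [hΨ, Finset.smul_sum, smul_smul]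
    have hJ : 2 * κ a ≤ J (κ a) (r • Ψ) := by
      have := hlow (insert a s) (fun j => r * c j) (κ a) (hκ a)
        (by simpa using hmin)
      rw [← hrΨ, hrr] at this
      simpa using this
    have hne : ∀ i ∈ s, i ≠ a := fun i hi h => has (h ▸ hi)
    have hO : OrthonormalOn B (insert a s) (Function.update φ a (r • Ψ)) := by
      have h0 : ∀ i ∈ s, B (φ i) (r • Ψ) = 0 := fun i hi => by
        rw [map_smul, horth i hi, smul_zero]
      intro i hi j hj
      rcases Finset.mem_insert.1 hi with hia | his <;> rcases Finset.mem_insert.1 hj with hja | hjs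
      · rw [hia, hja, Function.update_self, if_pos rfl]
        exact hrr
      · rw [hia, Function.update_self, Function.update_of_ne (hne j hjs), ← hB, h0 j hjs,
          if_neg (hne j hjs).symm, map_zero]
      · rw [hja, Function.update_self, Function.update_of_ne (hne i his), h0 i his,
          if_neg (hne i his)]
      · rw [Function.update_of_ne (hne i his), Function.update_of_ne (hne j hjs), hφ i his j hjs]
    obtain ⟨φ', hφ', hle⟩ := hmono k (κ a - k) hk
      (sub_nonneg.2 (hks a (Finset.mem_insert_self _ _))) _ _ hO
    refine ⟨φ', hφ', le_trans ?_ hle⟩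
    rw [Finset.sum_insert has, Finset.sum_insert has, add_sub_cancel, Function.update_self]
    refine add_le_add hJ (hsum.trans_eq (Finset.sum_congr rfl fun i hi => ?_))
    rw [Function.update_of_ne (hne i hi)]

lemma sum_norm_sq_le_of_orthonormalOn {ι X : Type*} [DecidableEq ι] [AddCommGroup X] [Module ℂ X]
    (B : X →ₗ⋆[ℂ] X →ₗ[ℂ] ℂ) (hB : ∀ x y, (starRingEnd ℂ) (B x y) = B y x)
    (hB0 : ∀ x, 0 ≤ (B x x).re) {s : Finset ι} {φ : ι → X} (hφ : OrthonormalOn B s φ) (e : X) :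
    ∑ i ∈ s, ‖B e (φ i)‖ ^ 2 ≤ (B e e).re := by
  set y : X := ∑ i ∈ s, B (φ i) e • φ i with hy
  have h1 : B e y = ∑ i ∈ s, ((‖B e (φ i)‖ ^ 2 : ℝ) : ℂ) := by
    rw [hy, map_sum]
    refine Finset.sum_congr rfl fun i _ => ?_
    rw [map_smul, smul_eq_mul, ← hB e, Complex.conj_mul']
    norm_cast
  have h2 : ∀ i ∈ s, B (φ i) y = B (φ i) e := by
    intro i hi
    rw [hy, map_sum, Finset.sum_eq_single_of_mem i hi]
    · rw [map_smul, hφ i hi i hi, if_pos rfl, smul_eq_mul, mul_one]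
    · intro j hj hji
      rw [map_smul, hφ i hi j hj, if_neg hji.symm, smul_zero]
  have hy' : ∀ v, B y v = ∑ i ∈ s, (starRingEnd ℂ) (B (φ i) e) * B (φ i) v := fun v => by
    simp only [hy, map_sum, LinearMap.map_smulₛₗ, LinearMap.sum_apply, LinearMap.smul_apply,
      smul_eq_mul]
  have h3 : B y y = B y e := by
    rw [hy' y, hy' e]
    exact Finset.sum_congr rfl fun i hi => by rw [h2 i hi]
  have h4 := hB0 (e - y)
  have h5 : (B y e).re = (B e y).re := by rw [← hB e y, Complex.conj_re]
  simp only [map_sub, LinearMap.sub_apply, Complex.sub_re, h3] at h4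
  rw [h5] at h4
  have h6 : (B e y).re = ∑ i ∈ s, ‖B e (φ i)‖ ^ 2 := by
    rw [h1, ← Complex.ofReal_sum, Complex.ofReal_re]
  linarith

open BoundedContinuousFunction in
lemma norm_coord_le {n : ℕ} (f : ℝ →ᵇ (Fin n → ℂ)) (x : ℝ) (a : Fin n) : ‖f x a‖ ≤ ‖f‖ :=
  (norm_le_pi_norm (f x) a).trans (f.norm_coe_le_norm x)

open BoundedContinuousFunction in
lemma integrable_coord_mul {n : ℕ} (f : ℝ →ᵇ (Fin n → ℂ)) (a : Fin n) {q : ℝ → ℂ} (hq : Integrable q) :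
    Integrable fun x => q x * f x a :=
  hq.mul_bdd (c := ‖f‖) ((continuous_apply a).comp f.continuous).aestronglyMeasurable
    (.of_forall fun x => norm_coord_le f x a)

open BoundedContinuousFunction in
lemma integrable_mulVec_coord {n : ℕ} {Q : ℝ → Matrix (Fin n) (Fin n) ℂ}
    (hQi : ∀ a b, Integrable fun x => Q x a b) (f : ℝ →ᵇ (Fin n → ℂ)) (a : Fin n) :
    Integrable fun x => (Q x *ᵥ f x) a := by
  simp only [mulVec, dotProduct]
  exact integrable_finsetSum _ fun b _ => integrable_coord_mul f b (hQi a b)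

open BoundedContinuousFunction in
lemma integrable_dotProduct {n : ℕ} {h : ℝ → Fin n → ℂ} (hh : ∀ a, Integrable fun x => h x a)
    (f : ℝ →ᵇ (Fin n → ℂ)) : Integrable fun x => star (f x) ⬝ᵥ h x := by
  simp only [dotProduct]
  refine integrable_finsetSum _ fun a _ => ?_
  refine (hh a).bdd_mul (c := ‖f‖) ?_ (.of_forall fun x => ?_)
  · exact (continuous_star.comp ((continuous_apply a).comp f.continuous)).aestronglyMeasurable
  · rw [Pi.star_apply, norm_star]
    exact norm_coord_le f x a

open BoundedContinuousFunction in
/-- The sesquilinear form `(f, g) ↦ ∫ ⟨f, Q g⟩` on bounded continuous functions. -/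
noncomputable def potentialForm {n : ℕ} (Q : ℝ → Matrix (Fin n) (Fin n) ℂ)
    (hQi : ∀ a b, Integrable fun x => Q x a b) :
    (ℝ →ᵇ (Fin n → ℂ)) →ₗ⋆[ℂ] (ℝ →ᵇ (Fin n → ℂ)) →ₗ[ℂ] ℂ :=
  have hi : ∀ f g : ℝ →ᵇ (Fin n → ℂ), Integrable fun x => star (f x) ⬝ᵥ (Q x *ᵥ g x) :=
    fun f g => integrable_dotProduct (integrable_mulVec_coord hQi g) f
  LinearMap.mk₂'ₛₗ (starRingEnd ℂ) (RingHom.id ℂ) (fun f g => ∫ x, star (f x) ⬝ᵥ (Q x *ᵥ g x))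
    (fun f₁ f₂ g => by
      rw [← integral_add (hi _ _) (hi _ _)]
      simp [add_dotProduct])
    (fun c f g => by
      rw [smul_eq_mul, ← integral_const_mul]
      simp)
    (fun f g₁ g₂ => by
      rw [← integral_add (hi _ _) (hi _ _)]
      simp [mulVec_add, dotProduct_add])
    (fun c f g => by
      rw [RingHom.id_apply, smul_eq_mul, ← integral_const_mul]
      simp [mulVec_smul])

open BoundedContinuousFunction in
lemma potentialForm_apply {n : ℕ} (Q : ℝ → Matrix (Fin n) (Fin n) ℂ)
    (hQi : ∀ a b, Integrable fun x => Q x a b) (f g : ℝ →ᵇ (Fin n → ℂ)) :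
    potentialForm Q hQi f g = ∫ x, star (f x) ⬝ᵥ (Q x *ᵥ g x) := rfl

open BoundedContinuousFunction in
lemma conj_potentialForm {n : ℕ} {Q : ℝ → Matrix (Fin n) (Fin n) ℂ} (hQ : ∀ x, (Q x).PosSemidef)
    (hQi : ∀ a b, Integrable fun x => Q x a b) (f g : ℝ →ᵇ (Fin n → ℂ)) :
    (starRingEnd ℂ) (potentialForm Q hQi f g) = potentialForm Q hQi g f := by
  rw [potentialForm_apply, potentialForm_apply, ← integral_conj]
  refine integral_congr_ae (.of_forall fun x => ?_)
  simp only
  rw [starRingEnd_apply, star_dotProduct, star_mulVec, (hQ x).1.eq, dotProduct_mulVec, star_star]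

open BoundedContinuousFunction in
lemma potentialForm_self_nonneg {n : ℕ} {Q : ℝ → Matrix (Fin n) (Fin n) ℂ}
    (hQ : ∀ x, (Q x).PosSemidef) (hQi : ∀ a b, Integrable fun x => Q x a b) (f : ℝ →ᵇ (Fin n → ℂ)) :
    0 ≤ (potentialForm Q hQi f f).re := by
  have := integral_re (integrable_dotProduct (integrable_mulVec_coord hQi f) f)
  rw [potentialForm_apply]
  simp only [RCLike.re_to_complex] at this
  rw [← this]
  exact integral_nonneg fun x => (hQ x).re_dotProduct_nonneg (f x)

open BoundedContinuousFunction in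
/-- Multiplication of a bounded continuous function by the phase `phase p`. -/
noncomputable def phaseMul {n : ℕ} (p : ℝ) (f : ℝ →ᵇ (Fin n → ℂ)) : ℝ →ᵇ (Fin n → ℂ) :=
  BoundedContinuousFunction.ofNormedAddCommGroup (fun x => phase p x • f x)
    ((continuous_phase.comp (by fun_prop : Continuous fun x : ℝ => (p, x))).smul f.continuous) ‖f‖
    (fun x => by rw [norm_smul, norm_phase, one_mul]; exact f.norm_coe_le_norm x)

open BoundedContinuousFunction in
lemma phaseMul_apply {n : ℕ} (p : ℝ) (f : ℝ →ᵇ (Fin n → ℂ)) (x : ℝ) :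
    phaseMul p f x = phase p x • f x := rfl

open BoundedContinuousFunction in
lemma potentialForm_phaseMul {n : ℕ} (Q : ℝ → Matrix (Fin n) (Fin n) ℂ)
    (hQi : ∀ a b, Integrable fun x => Q x a b) (p : ℝ) (f g : ℝ →ᵇ (Fin n → ℂ)) :
    potentialForm Q hQi (phaseMul p f) (phaseMul p g) = potentialForm Q hQi f g := by
  rw [potentialForm_apply, potentialForm_apply]
  refine integral_congr_ae (.of_forall fun x => ?_)
  simp only [phaseMul_apply, mulVec_smul, star_smul, smul_dotProduct, dotProduct_smul, ← mul_assoc,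
    smul_eq_mul]
  rw [← starRingEnd_apply, mul_comm (phase p x), conj_phase_mul_phase, sub_self]
  simp [phase]

open BoundedContinuousFunction in
/-- The form `expForm k` evaluated on `Q f`. -/
noncomputable def potentialExpForm {n : ℕ} (Q : ℝ → Matrix (Fin n) (Fin n) ℂ) (k : ℝ)
    (f : ℝ →ᵇ (Fin n → ℂ)) : ℝ :=
  ∑ a, (expForm k fun x => (Q x *ᵥ f x) a).re

open BoundedContinuousFunction in
lemma exists_orthonormalOn_potentialExpForm_le {n : ℕ} {ι : Type*} [DecidableEq ι]
    {Q : ℝ → Matrix (Fin n) (Fin n) ℂ} (hQi : ∀ a b, Integrable fun x => Q x a b) {k δ : ℝ}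
    (hk : 0 ≤ k) (hδ : 0 ≤ δ) (s : Finset ι) (φ : ι → ℝ →ᵇ (Fin n → ℂ))
    (hφ : OrthonormalOn (potentialForm Q hQi) s φ) :
    ∃ φ' : ι → ℝ →ᵇ (Fin n → ℂ), OrthonormalOn (potentialForm Q hQi) s φ' ∧
      ∑ i ∈ s, potentialExpForm Q (k + δ) (φ i) ≤ ∑ i ∈ s, potentialExpForm Q k (φ' i) := by
  obtain ⟨μ, hμ1, hμ⟩ := exists_measure_integral_cexp_eq hδ
  have key : ∀ i a, Integrable (fun p => expForm k fun x => (Q x *ᵥ phaseMul p (φ i) x) a) μ ∧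
      ∫ p, expForm k (fun x => (Q x *ᵥ phaseMul p (φ i) x) a) ∂μ =
        expForm (k + δ) fun x => (Q x *ᵥ φ i x) a := by
    intro i a
    have := integral_expForm_phase (δ := δ) hk hμ (integrable_mulVec_coord hQi (φ i) a)
    simpa only [phaseMul_apply, mulVec_smul, Pi.smul_apply, smul_eq_mul] using this
  have hi : Integrable (fun p => ∑ i ∈ s, potentialExpForm Q k (phaseMul p (φ i))) μ :=
    integrable_finsetSum _ fun i _ => integrable_finsetSum _ fun a _ => (key i a).1.re
  obtain ⟨p, hp⟩ := exists_integral_le hi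
  refine ⟨fun i => phaseMul p (φ i), fun i hi j hj => ?_, le_of_eq_of_le ?_ hp⟩
  · rw [potentialForm_phaseMul, hφ i hi j hj]
  · unfold potentialExpForm
    have hre : ∀ i a, Integrable
        (fun p => (expForm k fun x => (Q x *ᵥ phaseMul p (φ i) x) a).re) μ := fun i a => (key i a).1.re
    rw [integral_finsetSum _ fun i _ => integrable_finsetSum _ fun a _ => hre i a]
    refine Finset.sum_congr rfl fun i _ => ?_
    rw [integral_finsetSum _ fun a _ => hre i a]
    refine Finset.sum_congr rfl fun a _ => ?_
    rw [← (key i a).2]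
    exact (integral_re (key i a).1).symm

open BoundedContinuousFunction in
lemma sum_potentialExpForm_zero_le {n : ℕ} {ι : Type*} [DecidableEq ι]
    {Q : ℝ → Matrix (Fin n) (Fin n) ℂ} (hQ : ∀ x, (Q x).PosSemidef)
    (hQi : ∀ a b, Integrable fun x => Q x a b) (s : Finset ι) (φ : ι → ℝ →ᵇ (Fin n → ℂ))
    (hφ : OrthonormalOn (potentialForm Q hQi) s φ) :
    ∑ i ∈ s, potentialExpForm Q 0 (φ i) ≤ ∫ x, (Q x).trace.re := by
  set e : Fin n → ℝ →ᵇ (Fin n → ℂ) := fun a => BoundedContinuousFunction.const ℝ (Pi.single a 1) with he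
  have h1 : ∀ i, potentialExpForm Q 0 (φ i) = ∑ a, ‖potentialForm Q hQi (e a) (φ i)‖ ^ 2 := by
    intro i
    unfold potentialExpForm
    refine Finset.sum_congr rfl fun a _ => ?_
    rw [expForm_zero, potentialForm_apply]
    congr 3
    ext x
    simp [he]
  have h2 : ∀ a, (potentialForm Q hQi (e a) (e a)).re = ∫ x, (Q x a a).re := by
    intro a
    rw [potentialForm_apply]
    refine Eq.trans ?_ (integral_re (hQi a a)).symm
    congr 2
    ext x
    simp [he]
  simp only [h1]
  rw [Finset.sum_comm]
  calc ∑ a, ∑ i ∈ s, ‖potentialForm Q hQi (e a) (φ i)‖ ^ 2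
      ≤ ∑ a, (potentialForm Q hQi (e a) (e a)).re := Finset.sum_le_sum fun a _ =>
        sum_norm_sq_le_of_orthonormalOn _ (conj_potentialForm hQ hQi)
          (potentialForm_self_nonneg hQ hQi) hφ (e a)
    _ = ∫ x, (Q x).trace.re := by
        simp only [h2, trace, diag_apply, Complex.re_sum]
        have hre : ∀ a, Integrable fun x => (Q x a a).re := fun a => (hQi a a).re
        rw [integral_finsetSum _ fun a _ => hre a]

open BoundedContinuousFunction in
lemma le_potentialExpForm {n : ℕ} {Q : ℝ → Matrix (Fin n) (Fin n) ℂ} (hQ : ∀ x, (Q x).PosSemidef)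
    (hQi : ∀ a b, Integrable fun x => Q x a b) {k : ℝ} (hk : 0 < k) (f : ℝ →ᵇ (Fin n → ℂ))
    {f' : ℝ → Fin n → ℂ} (hf : ∀ x a, HasDerivAt (fun x => f x a) (f' x a) x)
    (hf'c : ∀ a, Continuous fun x => f' x a) (hfi : ∀ a, Integrable fun x => ‖f x a‖ ^ 2)
    (hf'i : ∀ a, Integrable fun x => ‖f' x a‖ ^ 2)
    (hle : ∑ a, ((∫ x, ‖f' x a‖ ^ 2) + k ^ 2 * ∫ x, ‖f x a‖ ^ 2) ≤ (potentialForm Q hQi f f).re) :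
    2 * k * (potentialForm Q hQi f f).re ≤ potentialExpForm Q k f := by
  have h1 := fun a => le_re_expForm hk (integrable_mulVec_coord hQi f a) (fun x => hf x a) (hf'c a)
    (fun x => norm_coord_le f x a) (hfi a) (hf'i a)
  have h2 := Finset.sum_le_sum fun a (_ : a ∈ Finset.univ) => h1 a
  rw [← Finset.mul_sum, Finset.sum_sub_distrib, ← Finset.mul_sum, ← Complex.re_sum] at h2
  have h3 : ∑ a, ∫ x, (starRingEnd ℂ) ((Q x *ᵥ f x) a) * f x a = potentialForm Q hQi f f := by
    rw [← integral_finsetSum, ← conj_potentialForm hQ, potentialForm_apply, ← integral_conj]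
    · refine integral_congr_ae (.of_forall fun x => ?_)
      simp [dotProduct, mul_comm]
    · intro a _
      exact integrable_coord_mul f a
        (LinearIsometryEquiv.integrable_comp_iff Complex.conjLIE |>.2 (integrable_mulVec_coord hQi f a))
  rw [h3] at h2
  refine le_trans ?_ h2
  gcongr
  linarith

open BoundedContinuousFunction in
/-- The sharp bound for `∑ κ_j`, given the variational inequality for the quadratic form of
`-d²/dx² - Q` on the span of the `ψ j`. -/
lemma sum_two_mul_le_integral_trace {n : ℕ} {ι : Type*} [Fintype ι] [DecidableEq ι]
    {Q : ℝ → Matrix (Fin n) (Fin n) ℂ} (hQ : ∀ x, (Q x).PosSemidef)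
    (hQi : ∀ a b, Integrable fun x => Q x a b) {κ : ι → ℝ} (hκ : ∀ i, 0 < κ i)
    (ψ : ι → ℝ →ᵇ (Fin n → ℂ)) {ψ' : ι → ℝ → Fin n → ℂ}
    (hψ : ∀ j x a, HasDerivAt (fun x => ψ j x a) (ψ' j x a) x)
    (hψ'c : ∀ j a, Continuous fun x => ψ' j x a)
    (hψi : ∀ j a, Integrable fun x => ‖ψ j x a‖ ^ 2)
    (hψ'i : ∀ j a, Integrable fun x => ‖ψ' j x a‖ ^ 2)
    (hpos : ∀ (s : Finset ι) (c : ι → ℂ), (∃ i ∈ s, c i ≠ 0) →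
      0 < ∑ a, ∫ x, ‖∑ i ∈ s, c i * ψ i x a‖ ^ 2)
    (hvar : ∀ (s : Finset ι) (c : ι → ℂ) (k : ℝ), 0 < k → (∀ i ∈ s, k ≤ κ i) →
      ∑ a, ((∫ x, ‖∑ i ∈ s, c i * ψ' i x a‖ ^ 2) + k ^ 2 * ∫ x, ‖∑ i ∈ s, c i * ψ i x a‖ ^ 2) ≤
        (potentialForm Q hQi (∑ i ∈ s, c i • ψ i) (∑ i ∈ s, c i • ψ i)).re) :
    ∑ i, 2 * κ i ≤ ∫ x, (Q x).trace.re := by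
  have hval : ∀ (s : Finset ι) (c : ι → ℂ) x a,
      (∑ i ∈ s, c i • ψ i) x a = ∑ i ∈ s, c i * ψ i x a := by
    intro s c x a
    simp
  have hL2 : ∀ (u : ι → ℝ → ℂ) (_ : ∀ i, Continuous (u i))
      (_ : ∀ i, Integrable fun x => ‖u i x‖ ^ 2) (s : Finset ι) (c : ι → ℂ),
      Integrable fun x => ‖∑ i ∈ s, c i * u i x‖ ^ 2 := by
    intro u hu hui s c
    have h := fun i => (memLp_two_iff_integrable_sq_norm (hu i).aestronglyMeasurable).2 (hui i)
    exact (memLp_finsetSum s fun i _ => (h i).const_mul (c i)).integrable_norm_pow two_ne_zero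
  have hψc : ∀ j a, Continuous fun x => ψ j x a := fun j a =>
    (continuous_apply a).comp (ψ j).continuous
  obtain ⟨φ, hφ, hle⟩ := exists_orthonormalOn_sum_le (potentialForm Q hQi)
    (conj_potentialForm hQ hQi) (potentialExpForm Q) κ hκ ψ
    (fun k δ hk hδ s φ hφ => exists_orthonormalOn_potentialExpForm_le hQi hk hδ s φ hφ)
    (fun s c hc => by
      obtain ⟨i, hi, hci⟩ := hc
      obtain ⟨m, hm, hmin⟩ := s.exists_min_image κ ⟨i, hi⟩
      refine lt_of_lt_of_le ?_ (hvar s c (κ m) (hκ m) hmin)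
      rw [Finset.sum_add_distrib, ← Finset.mul_sum]
      have := mul_pos (pow_pos (hκ m) 2) (hpos s c ⟨i, hi, hci⟩)
      have h0 : 0 ≤ ∑ a, ∫ x, ‖∑ i ∈ s, c i * ψ' i x a‖ ^ 2 :=
        Finset.sum_nonneg fun a _ => integral_nonneg fun x => sq_nonneg _
      linarith)
    (fun s c k hk hks => by
      refine le_potentialExpForm hQ hQi hk _ (f' := fun x a => ∑ i ∈ s, c i * ψ' i x a)
        (fun x a => ?_) (fun a => ?_) (fun a => ?_) (fun a => ?_) ?_
      · simp only [hval]
        exact HasDerivAt.fun_sum fun i _ => (hψ i x a).const_mul (c i)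
      · exact continuous_finsetSum _ fun i _ => (hψ'c i a).const_mul (c i)
      · simp only [hval]
        exact hL2 _ (fun i => hψc i a) (fun i => hψi i a) s c
      · exact hL2 _ (fun i => hψ'c i a) (fun i => hψ'i i a) s c
      · simp only [hval]
        exact hvar s c k hk hks)
    Finset.univ 0 le_rfl (fun i _ => (hκ i).le)
  exact hle.trans (sum_potentialExpForm_zero_le hQ hQi _ φ hφ)

lemma le_of_sq_le_mul_integral {ρ σ τ : ℝ → ℝ} (hρ0 : ∀ x, 0 ≤ ρ x) (hρi : Integrable ρ)
    (hτ0 : ∀ x, 0 ≤ τ x) (hτc : Continuous τ) (hσc : Continuous σ)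
    (hρ : ∀ x, HasDerivAt ρ (2 * σ x) x) (hστ : ∀ x, σ x ^ 2 ≤ ρ x * τ x) {δ : ℝ} (hδ : 0 < δ)
    {R x : ℝ} (hx : x ∈ Set.Icc (-R) R) :
    ρ x ≤ ρ 0 + δ * (∫ y in -R..R, τ y) + δ⁻¹ * ∫ y, ρ y := by
  have hR : -R ≤ R := hx.1.trans hx.2
  have hpt : ∀ y, ‖2 * σ y‖ ≤ δ * τ y + δ⁻¹ * ρ y := by
    intro y
    rw [Real.norm_eq_abs]
    refine abs_le_of_sq_le_sq ?_ (by have := hρ0 y; have := hτ0 y; positivity)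
    have h1 : (δ * τ y) * (δ⁻¹ * ρ y) = ρ y * τ y := by field_simp
    nlinarith [sq_nonneg (δ * τ y - δ⁻¹ * ρ y), hστ y]
  have h_int : IntegrableOn (fun y => δ * τ y + δ⁻¹ * ρ y) (Set.Ioc (-R) R) :=
    (((hτc.integrableOn_Icc).mono_set Set.Ioc_subset_Icc_self).const_mul δ).add
      (hρi.integrableOn.const_mul δ⁻¹)
  have hsub : Set.uIoc 0 x ⊆ Set.Ioc (-R) R := by
    intro y hy
    rcases le_total 0 x with h | h
    · rw [Set.uIoc_of_le h] at hy
      exact ⟨by linarith [hy.1, hx.2], hy.2.trans hx.2⟩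
    · rw [Set.uIoc_of_ge h] at hy
      exact ⟨hx.1.trans_lt hy.1, by linarith [hy.2, hx.1]⟩
  have h1 : ρ x - ρ 0 = ∫ y in 0..x, 2 * σ y :=
    (intervalIntegral.integral_eq_sub_of_hasDerivAt (fun y _ => hρ y)
      ((continuous_const.mul hσc).intervalIntegrable _ _)).symm
  have h2 : ‖∫ y in 0..x, 2 * σ y‖ ≤ ∫ y in Set.Ioc (-R) R, (δ * τ y + δ⁻¹ * ρ y) := by
    refine (intervalIntegral.norm_integral_le_integral_norm_uIoc).trans ?_
    refine (setIntegral_mono_on ?_ (h_int.mono_set hsub) measurableSet_uIoc fun y _ => hpt y).trans ?_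
    · exact ((continuous_const.mul hσc).norm.integrableOn_uIcc).mono_set Set.uIoc_subset_uIcc
    · refine setIntegral_mono_set h_int (.of_forall fun y => ?_) (LE.le.eventuallyLE hsub)
      have := hρ0 y
      have := hτ0 y
      positivity
  have h3 : ∫ y in Set.Ioc (-R) R, (δ * τ y + δ⁻¹ * ρ y) ≤
      δ * (∫ y in -R..R, τ y) + δ⁻¹ * ∫ y, ρ y := by
    rw [integral_add (((hτc.integrableOn_Icc).mono_set Set.Ioc_subset_Icc_self).const_mul δ)
      (hρi.integrableOn.const_mul δ⁻¹), integral_const_mul, integral_const_mul,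
      intervalIntegral.integral_of_le hR]
    have := setIntegral_le_integral (s := Set.Ioc (-R) R) hρi (.of_forall hρ0)
    gcongr
  have h4 := le_abs_self (ρ x - ρ 0)
  rw [h1] at h4
  rw [Real.norm_eq_abs] at h2
  linarith

/-- If `ρ ≥ 0` is integrable, `ρ' = 2σ`, `σ² ≤ ρτ` and `σ' ≥ τ - (q + M)ρ` with `q ≥ 0` integrable,
then `τ` is integrable and `ρ` is bounded. -/
lemma integrable_and_bounded_of_energy {ρ σ τ σ' q : ℝ → ℝ} {M : ℝ} (hρ0 : ∀ x, 0 ≤ ρ x)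
    (hρi : Integrable ρ) (hτ0 : ∀ x, 0 ≤ τ x) (hτc : Continuous τ)
    (hρ : ∀ x, HasDerivAt ρ (2 * σ x) x) (hσ : ∀ x, HasDerivAt σ (σ' x) x) (hσ'c : Continuous σ')
    (hστ : ∀ x, σ x ^ 2 ≤ ρ x * τ x) (hq0 : ∀ x, 0 ≤ q x) (hqi : Integrable q)
    (hM : 0 ≤ M) (hle : ∀ x, τ x - (q x + M) * ρ x ≤ σ' x) :
    Integrable τ ∧ ∃ C, ∀ x, ρ x ≤ C := by
  have hσc : Continuous σ := continuous_iff_continuousAt.2 fun x => (hσ x).continuousAt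
  have hρc : Continuous ρ := continuous_iff_continuousAt.2 fun x => (hρ x).continuousAt
  set Φ : ℝ → ℝ := fun R => ∫ y in -R..R, τ y with hΦ
  have hmono : ∀ {R S : ℝ}, 0 ≤ R → R ≤ S → Φ R ≤ Φ S := fun {R S} h0 h =>
    intervalIntegral.integral_mono_interval (by linarith) (by linarith) h (.of_forall hτ0)
      (hτc.intervalIntegrable _ _)
  have hA := fun {δ : ℝ} (hδ : 0 < δ) {R x : ℝ} (hx : x ∈ Set.Icc (-R) R) =>
    le_of_sq_le_mul_integral hρ0 hρi hτ0 hτc hσc hρ hστ hδ hx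
  set A := ∫ x, q x with hAdef
  set I := ∫ x, ρ x with hI
  have hA0 : 0 ≤ A := integral_nonneg hq0
  set δ : ℝ := (2 * (A + 1))⁻¹ with hδdef
  have hδ : 0 < δ := by positivity
  have hδA : A * δ ≤ 1 / 2 := by
    rw [hδdef, ← div_eq_mul_inv, div_le_iff₀ (by positivity)]
    linarith
  set K := A * (ρ 0 + δ⁻¹ * I) + M * I with hK
  have hB : ∀ R, 0 ≤ R → Φ R / 2 - K ≤ σ R - σ (-R) := by
    intro R hR
    have hRR : -R ≤ R := by linarith
    set S := ρ 0 + δ * Φ R + δ⁻¹ * I with hS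
    have hρS : ∀ x ∈ Set.Icc (-R) R, ρ x ≤ S := fun x hx => hA hδ hx
    have hS0 : 0 ≤ S := (hρ0 0).trans (hρS 0 ⟨by linarith, hR⟩)
    rw [← intervalIntegral.integral_eq_sub_of_hasDerivAt (fun x _ => hσ x)
      (hσ'c.intervalIntegrable _ _)]
    have h1 : ∫ x in -R..R, (τ x - (S * q x + M * ρ x)) ≤ ∫ x in -R..R, σ' x := by
      refine intervalIntegral.integral_mono_on hRR ?_ (hσ'c.intervalIntegrable _ _) fun x hx => ?_
      · exact (hτc.intervalIntegrable _ _).sub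
          ((hqi.intervalIntegrable.const_mul S).add (hρi.intervalIntegrable.const_mul M))
      · have := mul_le_mul_of_nonneg_left (hρS x hx) (hq0 x)
        linarith [hle x]
    refine le_trans ?_ h1
    rw [intervalIntegral.integral_sub (hτc.intervalIntegrable _ _)
      ((hqi.intervalIntegrable.const_mul S).add (hρi.intervalIntegrable.const_mul M)),
      intervalIntegral.integral_add (hqi.intervalIntegrable.const_mul S)
        (hρi.intervalIntegrable.const_mul M), intervalIntegral.integral_const_mul,
      intervalIntegral.integral_const_mul, intervalIntegral.integral_of_le hRR,
      intervalIntegral.integral_of_le hRR, intervalIntegral.integral_of_le hRR]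
    have h2 : ∫ x in Set.Ioc (-R) R, q x ≤ A := setIntegral_le_integral hqi (.of_forall hq0)
    have h3 : ∫ x in Set.Ioc (-R) R, ρ x ≤ I := setIntegral_le_integral hρi (.of_forall hρ0)
    have h4 : ∫ x in Set.Ioc (-R) R, τ x = Φ R := 
      (intervalIntegral.integral_of_le hRR).symm
    have h5 : 0 ≤ Φ R := intervalIntegral.integral_nonneg hRR fun x _ => hτ0 x
    have h6 := mul_le_mul_of_nonneg_left h2 hS0
    have h7 := mul_le_mul_of_nonneg_left h3 hM
    have h8 := mul_le_mul_of_nonneg_right hδA h5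
    rw [h4]
    have h9 : S * A = A * (ρ 0 + δ⁻¹ * I) + A * δ * Φ R := by rw [hS]; ring
    linarith
  have hbdd : ∃ C, ∀ R, 0 ≤ R → Φ R ≤ C := by
    by_contra! h
    obtain ⟨R₀, hR₀, hR⟩ := h (2 * (K + 1))
    have hge : ∀ R, R₀ ≤ R → 1 ≤ σ R - σ (-R) := fun R h => by
      linarith [hB R (hR₀.trans h), hmono hR₀ h]
    have hder : ∀ x, HasDerivAt (fun x => ρ x + ρ (-x) - 2 * x) (2 * σ x - 2 * σ (-x) - 2) x := by
      intro x
      have h1 := (hρ (-x)).scomp x (hasDerivAt_neg x)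
      have h2 := ((hρ x).add h1).sub ((hasDerivAt_id x).const_mul 2)
      refine h2.congr_deriv ?_
      simp only [smul_eq_mul]
      ring
    have hmon : MonotoneOn (fun x => ρ x + ρ (-x) - 2 * x) (Set.Ici R₀) := by
      refine monotoneOn_of_deriv_nonneg (convex_Ici R₀)
        (fun x _ => (hder x).continuousAt.continuousWithinAt)
        (fun x _ => (hder x).differentiableAt.differentiableWithinAt) fun x hx => ?_
      rw [(hder x).deriv]
      rw [interior_Ici] at hx
      linarith [hge x hx.le]
    have hbig : ∀ x ∈ Set.Ioi (R₀ + 1), ‖(1 : ℝ)‖ ≤ ρ x + ρ (-x) := by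
      intro x hx
      have hx' : R₀ + 1 < x := hx
      have := hmon (Set.self_mem_Ici (a := R₀)) (show x ∈ Set.Ici R₀ by simp; linarith) (by linarith)
      simp only at this
      rw [norm_one]
      linarith [hρ0 R₀, hρ0 (-R₀)]
    have hi : IntegrableOn (fun _ : ℝ => (1 : ℝ)) (Set.Ioi (R₀ + 1)) :=
      Integrable.mono' (hρi.add hρi.comp_neg).integrableOn aestronglyMeasurable_const
        ((ae_restrict_iff' measurableSet_Ioi).2 (.of_forall hbig))
    rw [integrableOn_const_iff] at hi
    simp at hi
  obtain ⟨C, hC⟩ := hbdd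
  have hτi : Integrable τ := by
    refine integrable_of_intervalIntegral_norm_bounded C (l := Filter.atTop)
      (a := fun R : ℝ => -R) (b := id) (fun R => ?_) Filter.tendsto_neg_atTop_atBot
      Filter.tendsto_id ?_
    · exact (hτc.integrableOn_Icc).mono_set Set.Ioc_subset_Icc_self
    · filter_upwards [Filter.eventually_ge_atTop 0] with R hR
      simpa [abs_of_nonneg (hτ0 _)] using hC R hR
  refine ⟨hτi, ρ 0 + 1 * C + 1⁻¹ * I, fun x => ?_⟩
  have hx : x ∈ Set.Icc (-|x|) |x| := ⟨neg_abs_le x, le_abs_self x⟩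
  have h1 := hA one_pos hx
  have h2 := hC |x| (abs_nonneg x)
  simp only [hΦ] at h2
  linarith

lemma hasDerivAt_re_conj_mul {u v : ℝ → ℂ} {u' v' : ℂ} {x : ℝ} (hu : HasDerivAt u u' x)
    (hv : HasDerivAt v v' x) :
    HasDerivAt (fun x => ((starRingEnd ℂ) (u x) * v x).re)
      ((starRingEnd ℂ) u' * v x + (starRingEnd ℂ) (u x) * v').re x :=
  Complex.reCLM.hasFDerivAt.comp_hasDerivAt x (hu.star.mul hv)

lemma hasDerivAt_sum_re_conj_mul {n : ℕ} {u u' u'' : ℝ → Fin n → ℂ}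
    (hu : ∀ x a, HasDerivAt (fun x => u x a) (u' x a) x)
    (hu' : ∀ x a, HasDerivAt (fun x => u' x a) (u'' x a) x) (x : ℝ) :
    HasDerivAt (fun x => ∑ a, ((starRingEnd ℂ) (u x a) * u' x a).re)
      (∑ a, ‖u' x a‖ ^ 2 + ∑ a, ((starRingEnd ℂ) (u x a) * u'' x a).re) x := by
  rw [← Finset.sum_add_distrib]
  refine HasDerivAt.fun_sum fun a _ => (hasDerivAt_re_conj_mul (hu x a) (hu' x a)).congr_deriv ?_
  rw [Complex.add_re, Complex.conj_mul']
  norm_cast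

/-- If `u ∈ L²` and `Re ⟨u, u''⟩ ≥ -(q + M)|u|²` with `q` integrable, then `u' ∈ L²` and `u` is
bounded. -/
lemma integrable_deriv_and_bounded {n : ℕ} {u u' u'' : ℝ → Fin n → ℂ}
    (hu : ∀ x a, HasDerivAt (fun x => u x a) (u' x a) x)
    (hu' : ∀ x a, HasDerivAt (fun x => u' x a) (u'' x a) x)
    (hu''c : ∀ a, Continuous fun x => u'' x a) (hui : ∀ a, Integrable fun x => ‖u x a‖ ^ 2)
    {q : ℝ → ℝ} {M : ℝ} (hq0 : ∀ x, 0 ≤ q x) (hqi : Integrable q) (hM : 0 ≤ M)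
    (hle : ∀ x, -((q x + M) * ∑ a, ‖u x a‖ ^ 2) ≤ ∑ a, ((starRingEnd ℂ) (u x a) * u'' x a).re) :
    (∀ a, Integrable fun x => ‖u' x a‖ ^ 2) ∧ ∃ C, ∀ x, ∑ a, ‖u x a‖ ^ 2 ≤ C := by
  have huc : ∀ a, Continuous fun x => u x a := fun a =>
    continuous_iff_continuousAt.2 fun x => (hu x a).continuousAt
  have hu'c : ∀ a, Continuous fun x => u' x a := fun a =>
    continuous_iff_continuousAt.2 fun x => (hu' x a).continuousAt
  obtain ⟨h1, h2⟩ := integrable_and_bounded_of_energy (ρ := fun x => ∑ a, ‖u x a‖ ^ 2)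
    (σ := fun x => ∑ a, ((starRingEnd ℂ) (u x a) * u' x a).re) (τ := fun x => ∑ a, ‖u' x a‖ ^ 2)
    (fun x => by positivity) (integrable_finsetSum _ fun a _ => hui a)
    (fun x => by positivity) (by fun_prop)
    (fun x => by
      rw [Finset.mul_sum]
      refine HasDerivAt.fun_sum fun a _ => (hasDerivAt_norm_sq_complex (hu x a)).congr_deriv ?_
      simp)
    (fun x => hasDerivAt_sum_re_conj_mul hu hu' x)
    (by
      have : ∀ a, Continuous fun x => ((starRingEnd ℂ) (u x a) * u'' x a).re := fun a =>
        Complex.continuous_re.comp ((Complex.continuous_conj.comp (huc a)).mul (hu''c a))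
      fun_prop)
    (fun x => by
      have h : |∑ a, ((starRingEnd ℂ) (u x a) * u' x a).re| ≤ ∑ a, ‖u x a‖ * ‖u' x a‖ := by
        refine (Finset.abs_sum_le_sum_abs _ _).trans (Finset.sum_le_sum fun a _ => ?_)
        refine (Complex.abs_re_le_norm _).trans_eq ?_
        rw [norm_mul, RCLike.norm_conj]
      rw [← sq_abs]
      exact (pow_le_pow_left₀ (abs_nonneg _) h 2).trans (Finset.sum_mul_sq_le_sq_mul_sq _ _ _))
    hq0 hqi hM (fun x => by linarith [hle x])
  refine ⟨fun a => h1.mono' (by fun_prop) (.of_forall fun x => ?_), h2⟩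
  rw [Real.norm_of_nonneg (by positivity)]
  exact Finset.single_le_sum (f := fun a => ‖u' x a‖ ^ 2) (fun b _ => by positivity)
    (Finset.mem_univ a)

lemma integral_sum_norm_sq_deriv {n : ℕ} {u u' u'' : ℝ → Fin n → ℂ}
    (hu : ∀ x a, HasDerivAt (fun x => u x a) (u' x a) x)
    (hu' : ∀ x a, HasDerivAt (fun x => u' x a) (u'' x a) x)
    (hui : ∀ a, Integrable fun x => ‖u x a‖ ^ 2) (hu'i : ∀ a, Integrable fun x => ‖u' x a‖ ^ 2)
    (hi : Integrable fun x => ∑ a, ((starRingEnd ℂ) (u x a) * u'' x a).re) :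
    ∑ a, ∫ x, ‖u' x a‖ ^ 2 = -∫ x, ∑ a, ((starRingEnd ℂ) (u x a) * u'' x a).re := by
  have huc : ∀ a, Continuous fun x => u x a := fun a =>
    continuous_iff_continuousAt.2 fun x => (hu x a).continuousAt
  have hu'c : ∀ a, Continuous fun x => u' x a := fun a =>
    continuous_iff_continuousAt.2 fun x => (hu' x a).continuousAt
  have h1 : Integrable fun x => ∑ a, ‖u' x a‖ ^ 2 := integrable_finsetSum _ fun a _ => hu'i a
  have h0 := integral_eq_zero_of_hasDerivAt_of_integrable
    (fun x => hasDerivAt_sum_re_conj_mul hu hu' x) (h1.add hi)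
    (integrable_finsetSum _ fun a _ => (integrable_conj_mul (huc a) (hu'c a) (hui a) (hu'i a)).re)
  rw [integral_add h1 hi, integral_finsetSum _ fun a _ => hu'i a] at h0
  linarith

lemma integral_sum_conj_mul_of_orthonormal {n : ℕ} {ι : Type*} [DecidableEq ι]
    {ψ : ι → ℝ → Fin n → ℂ}
    (hi : ∀ i j a, Integrable fun x => (starRingEnd ℂ) (ψ i x a) * ψ j x a)
    (horth : ∀ i j, (∫ x, ∑ a, (starRingEnd ℂ) (ψ i x a) * ψ j x a) = if i = j then 1 else 0)
    (s : Finset ι) (c d : ι → ℂ) :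
    ∫ x, ∑ a, (starRingEnd ℂ) (∑ i ∈ s, c i * ψ i x a) * ∑ i ∈ s, d i * ψ i x a =
      ∑ i ∈ s, (starRingEnd ℂ) (c i) * d i := by
  have h1 : ∀ x, ∑ a, (starRingEnd ℂ) (∑ i ∈ s, c i * ψ i x a) * ∑ i ∈ s, d i * ψ i x a =
      ∑ i ∈ s, ∑ j ∈ s, (starRingEnd ℂ) (c i) * d j *
        ∑ a, (starRingEnd ℂ) (ψ i x a) * ψ j x a := by
    intro x
    simp only [map_sum, map_mul, Finset.sum_mul_sum]
    rw [Finset.sum_comm]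
    refine Finset.sum_congr rfl fun i _ => ?_
    rw [Finset.sum_comm]
    refine Finset.sum_congr rfl fun j _ => ?_
    rw [Finset.mul_sum]
    refine Finset.sum_congr rfl fun a _ => ?_
    ring
  have h2 : ∀ i j, Integrable fun x => (starRingEnd ℂ) (c i) * d j *
      ∑ a, (starRingEnd ℂ) (ψ i x a) * ψ j x a := fun i j =>
    (integrable_finsetSum _ fun a _ => hi i j a).const_mul _
  simp only [h1]
  rw [integral_finsetSum _ fun i _ => integrable_finsetSum _ fun j _ => h2 i j]
  refine Finset.sum_congr rfl fun i his => ?_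
  rw [integral_finsetSum _ fun j _ => h2 i j, Finset.sum_eq_single_of_mem i his]
  · rw [integral_const_mul, horth, if_pos rfl, mul_one]
  · intro j _ hji
    rw [integral_const_mul, horth, if_neg hji.symm, mul_zero]

lemma re_dotProduct_mulVec_le {n : ℕ} (A : Matrix (Fin n) (Fin n) ℂ) (v : Fin n → ℂ) :
    (star v ⬝ᵥ (A *ᵥ v)).re ≤ (∑ a, ∑ b, ‖A a b‖) * ∑ a, ‖v a‖ ^ 2 := by
  have hv : ∀ a, ‖v a‖ ^ 2 ≤ ∑ a, ‖v a‖ ^ 2 := fun a =>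
    Finset.single_le_sum (f := fun a => ‖v a‖ ^ 2) (fun b _ => by positivity) (Finset.mem_univ a)
  refine (Complex.re_le_norm _).trans ?_
  rw [Finset.sum_mul]
  refine (norm_sum_le _ _).trans (Finset.sum_le_sum fun a _ => ?_)
  rw [Finset.sum_mul, mulVec, dotProduct, Finset.mul_sum]
  refine (norm_sum_le _ _).trans (Finset.sum_le_sum fun b _ => ?_)
  rw [norm_mul, norm_mul, Pi.star_apply, norm_star]
  have h1 : ‖v a‖ * ‖v b‖ ≤ ∑ a, ‖v a‖ ^ 2 := by
    nlinarith [sq_nonneg (‖v a‖ - ‖v b‖), hv a, hv b]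
  calc ‖v a‖ * (‖A a b‖ * ‖v b‖) = ‖A a b‖ * (‖v a‖ * ‖v b‖) := by ring
    _ ≤ _ := by gcongr

open BoundedContinuousFunction in
/-- The Lieb–Thirring inequality for `γ = 1/2`, with a shift of the spectral parameter by `μ`. -/
lemma sum_sqrt_le_integral_trace {n : ℕ} {ι : Type*} [Fintype ι] [DecidableEq ι]
    {W Q : ℝ → Matrix (Fin n) (Fin n) ℂ} (hWc : Continuous W) (hW : ∀ x, (W x).PosSemidef)
    (hQ : ∀ x, (Q x).PosSemidef) (hQi : ∀ a b, Integrable fun x => Q x a b) {μ : ℝ} (hμ : 0 ≤ μ)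
    (hWQ : ∀ x v, (star v ⬝ᵥ (W x *ᵥ v)).re ≤ (star v ⬝ᵥ (Q x *ᵥ v)).re + μ * ∑ a, ‖v a‖ ^ 2)
    {ψ ψ' ψ'' : ι → ℝ → Fin n → ℂ} (hψ : ∀ i x a, HasDerivAt (fun x => ψ i x a) (ψ' i x a) x)
    (hψ' : ∀ i x a, HasDerivAt (fun x => ψ' i x a) (ψ'' i x a) x)
    (hψi : ∀ i a, Integrable fun x => ‖ψ i x a‖ ^ 2) {E : ι → ℝ} (hE : ∀ i, μ < E i)
    (heq : ∀ i x a, ψ'' i x a = -(W x *ᵥ ψ i x) a + E i * ψ i x a)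
    (horth : ∀ i j, (∫ x, ∑ a, (starRingEnd ℂ) (ψ i x a) * ψ j x a) = if i = j then 1 else 0) :
    ∑ i, 2 * √(E i - μ) ≤ ∫ x, (Q x).trace.re := by
  have hψc : ∀ i a, Continuous fun x => ψ i x a := fun i a =>
    continuous_iff_continuousAt.2 fun x => (hψ i x a).continuousAt
  have hψ'c : ∀ i a, Continuous fun x => ψ' i x a := fun i a =>
    continuous_iff_continuousAt.2 fun x => (hψ' i x a).continuousAt
  have hψ''c : ∀ i a, Continuous fun x => ψ'' i x a := fun i a => by
    simp only [heq]
    have h1 : Continuous fun x => W x *ᵥ ψ i x := hWc.matrix_mulVec (continuous_pi (hψc i))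
    exact ((continuous_apply a).comp h1).neg.add (continuous_const.mul (hψc i a))
  have hdot : ∀ (v w : Fin n → ℂ), ∑ a, ((starRingEnd ℂ) (v a) * w a).re = (star v ⬝ᵥ w).re :=
    fun v w => by simp [dotProduct]
  have hW0 : ∀ x v, 0 ≤ (star v ⬝ᵥ (W x *ᵥ v)).re := fun x v => (hW x).re_dotProduct_nonneg v
  have hreg : ∀ i, (∀ a, Integrable fun x => ‖ψ' i x a‖ ^ 2) ∧
      ∃ C, ∀ x, ∑ a, ‖ψ i x a‖ ^ 2 ≤ C := by
    intro i
    refine integrable_deriv_and_bounded (hψ i) (hψ' i) (hψ''c i) (hψi i)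
      (q := fun x => ∑ a, ∑ b, ‖Q x a b‖) (M := μ) (fun x => by positivity)
      (integrable_finsetSum _ fun a _ => integrable_finsetSum _ fun b _ => (hQi a b).norm) hμ
      fun x => ?_
    have h1 : ∑ a, ((starRingEnd ℂ) (ψ i x a) * ψ'' i x a).re =
        -(star (ψ i x) ⬝ᵥ (W x *ᵥ ψ i x)).re + E i * ∑ a, ‖ψ i x a‖ ^ 2 := by
      rw [← hdot, Finset.mul_sum, ← Finset.sum_neg_distrib, ← Finset.sum_add_distrib]
      refine Finset.sum_congr rfl fun a _ => ?_
      rw [heq, mul_add, mul_neg, Complex.add_re, Complex.neg_re, mul_left_comm, Complex.conj_mul']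
      norm_cast
    have h2 := hWQ x (ψ i x)
    have h3 := re_dotProduct_mulVec_le (Q x) (ψ i x)
    have h4 : 0 ≤ E i * ∑ a, ‖ψ i x a‖ ^ 2 := by
      have := hμ.trans (hE i).le
      positivity
    rw [h1]
    linarith
  choose hψ'i C hC using hreg
  let Ψ : ι → ℝ →ᵇ (Fin n → ℂ) := fun i =>
    BoundedContinuousFunction.ofNormedAddCommGroup (ψ i) (continuous_pi (hψc i)) (√(C i))
      fun x => (pi_norm_le_iff_of_nonneg (Real.sqrt_nonneg _)).2 fun a =>
        Real.le_sqrt_of_sq_le ((Finset.single_le_sum (f := fun a => ‖ψ i x a‖ ^ 2)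
          (fun b _ => by positivity) (Finset.mem_univ a)).trans (hC i x))
  have hΨ : ∀ i x a, Ψ i x a = ψ i x a := fun i x a => rfl
  have hval : ∀ (s : Finset ι) (c : ι → ℂ) x a,
      (∑ i ∈ s, c i • Ψ i) x a = ∑ i ∈ s, c i * ψ i x a := by
    intro s c x a
    simp [hΨ]
  have hii : ∀ i j a, Integrable fun x => (starRingEnd ℂ) (ψ i x a) * ψ j x a := fun i j a =>
    integrable_conj_mul (hψc i a) (hψc j a) (hψi i a) (hψi j a)
  have hL2 : ∀ (u : ι → ℝ → ℂ) (_ : ∀ i, Continuous (u i))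
      (_ : ∀ i, Integrable fun x => ‖u i x‖ ^ 2) (s : Finset ι) (c : ι → ℂ),
      Integrable fun x => ‖∑ i ∈ s, c i * u i x‖ ^ 2 := by
    intro u hu hui s c
    have h := fun i => (memLp_two_iff_integrable_sq_norm (hu i).aestronglyMeasurable).2 (hui i)
    exact (memLp_finsetSum s fun i _ => (h i).const_mul (c i)).integrable_norm_pow two_ne_zero
  have hnorm : ∀ (s : Finset ι) (c : ι → ℂ),
      ∑ a, ∫ x, ‖∑ i ∈ s, c i * ψ i x a‖ ^ 2 = ∑ i ∈ s, ‖c i‖ ^ 2 := by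
    intro s c
    rw [← integral_finsetSum _ fun a _ => hL2 _ (fun i => hψc i a) (fun i => hψi i a) s c]
    have := integral_sum_conj_mul_of_orthonormal hii horth s c c
    simp only [Complex.conj_mul'] at this
    rw [← Complex.ofReal_inj, ← integral_complex_ofReal]
    push_cast
    exact this
  have hsum := sum_two_mul_le_integral_trace hQ hQi (κ := fun i => √(E i - μ))
    (fun i => Real.sqrt_pos.2 (sub_pos.2 (hE i))) Ψ (ψ' := ψ') hψ hψ'c hψi hψ'i
    (fun s c ⟨i, hi, hci⟩ => by
      simp only [hΨ]
      rw [hnorm]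
      exact Finset.sum_pos' (fun j _ => by positivity) ⟨i, hi, by positivity⟩)
    (fun s c k hk hks => by
      simp only [hΨ]
      set u : ℝ → Fin n → ℂ := fun x a => ∑ i ∈ s, c i * ψ i x a with hu
      set v : ℝ → Fin n → ℂ := fun x a => ∑ i ∈ s, (c i * E i) * ψ i x a with hv
      set u'' : ℝ → Fin n → ℂ := fun x a => ∑ i ∈ s, c i * ψ'' i x a with hu''
      have huc : ∀ a, Continuous fun x => u x a := fun a =>
        continuous_finsetSum _ fun i _ => continuous_const.mul (hψc i a)
      have hvc : ∀ a, Continuous fun x => v x a := fun a =>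
        continuous_finsetSum _ fun i _ => continuous_const.mul (hψc i a)
      have hui : ∀ a, Integrable fun x => ‖u x a‖ ^ 2 := fun a =>
        hL2 _ (fun i => hψc i a) (fun i => hψi i a) s c
      have hvi : ∀ a, Integrable fun x => ‖v x a‖ ^ 2 := fun a =>
        hL2 _ (fun i => hψc i a) (fun i => hψi i a) s fun i => c i * E i
      have hW' : ∀ x a, u'' x a = -(W x *ᵥ u x) a + v x a := by
        intro x a
        have : u x = ∑ i ∈ s, c i • ψ i x := by
          ext a
          simp [hu]
        rw [this, mulVec_sum, Finset.sum_apply, ← Finset.sum_neg_distrib, hv,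
          ← Finset.sum_add_distrib]
        refine Finset.sum_congr rfl fun i _ => ?_
        rw [heq, mulVec_smul, Pi.smul_apply, smul_eq_mul]
        ring
      have huu : ∀ x, ∑ a, ((starRingEnd ℂ) (u x a) * u'' x a).re =
          -(star (u x) ⬝ᵥ (W x *ᵥ u x)).re + ∑ a, ((starRingEnd ℂ) (u x a) * v x a).re := by
        intro x
        rw [← hdot, ← Finset.sum_neg_distrib, ← Finset.sum_add_distrib]
        refine Finset.sum_congr rfl fun a _ => ?_
        rw [hW', mul_add, mul_neg, Complex.add_re, Complex.neg_re]
      have hUQ : Integrable fun x => star (u x) ⬝ᵥ (Q x *ᵥ u x) := by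
        have := integrable_dotProduct (integrable_mulVec_coord hQi (∑ i ∈ s, c i • Ψ i))
          (∑ i ∈ s, c i • Ψ i)
        refine this.congr (.of_forall fun x => ?_)
        have : (∑ i ∈ s, c i • Ψ i) x = u x := funext fun a => hval s c x a
        simp only [this]
      have hUQ' : Integrable fun x => (star (u x) ⬝ᵥ (Q x *ᵥ u x)).re := hUQ.re
      have hρ : Integrable fun x => μ * ∑ a, ‖u x a‖ ^ 2 :=
        (integrable_finsetSum _ fun a _ => hui a).const_mul μ
      have hUW : Integrable fun x => (star (u x) ⬝ᵥ (W x *ᵥ u x)).re := by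
        refine (hUQ'.add hρ).mono' ?_ (.of_forall fun x => ?_)
        · have h1 : Continuous u := continuous_pi huc
          exact (Complex.continuous_re.comp
            (h1.star.dotProduct (hWc.matrix_mulVec h1))).aestronglyMeasurable
        · rw [Real.norm_of_nonneg (hW0 _ _)]
          exact hWQ x (u x)
      have huv : Integrable fun x => ∑ a, ((starRingEnd ℂ) (u x a) * v x a) :=
        integrable_finsetSum _ fun a _ => integrable_conj_mul (huc a) (hvc a) (hui a) (hvi a)
      have huv' : Integrable fun x => ∑ a, ((starRingEnd ℂ) (u x a) * v x a).re :=
        integrable_finsetSum _ fun a _ => (integrable_conj_mul (huc a) (hvc a) (hui a) (hvi a)).re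
      have hi : Integrable fun x => ∑ a, ((starRingEnd ℂ) (u x a) * u'' x a).re := by
        simp only [huu]
        exact hUW.neg.add huv'
      have hmain := integral_sum_norm_sq_deriv (u := u)
        (u' := fun x a => ∑ i ∈ s, c i * ψ' i x a) (u'' := u'')
        (fun x a => HasDerivAt.fun_sum fun i _ => (hψ i x a).const_mul (c i))
        (fun x a => HasDerivAt.fun_sum fun i _ => (hψ' i x a).const_mul (c i)) hui
        (fun a => hL2 _ (fun i => hψ'c i a) (fun i => hψ'i i a) s c) hi
      simp only [huu] at hmain
      have hUW' : Integrable fun x => -(star (u x) ⬝ᵥ (W x *ᵥ u x)).re := hUW.neg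
      rw [integral_add hUW' huv', integral_neg] at hmain
      have h1 : ∫ x, ∑ a, ((starRingEnd ℂ) (u x a) * v x a).re = ∑ i ∈ s, E i * ‖c i‖ ^ 2 := by
        have h2 := integral_sum_conj_mul_of_orthonormal hii horth s c fun i => c i * E i
        have h3 := integral_re huv
        rw [h2] at h3
        simp only [RCLike.re_to_complex, Complex.re_sum] at h3
        rw [h3]
        refine Finset.sum_congr rfl fun i _ => ?_
        rw [← mul_assoc, Complex.conj_mul', mul_comm]
        norm_cast
      have h4 : ∫ x, (star (u x) ⬝ᵥ (W x *ᵥ u x)).re ≤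
          (potentialForm Q hQi (∑ i ∈ s, c i • Ψ i) (∑ i ∈ s, c i • Ψ i)).re +
            μ * ∑ i ∈ s, ‖c i‖ ^ 2 := by
        have h5 : (potentialForm Q hQi (∑ i ∈ s, c i • Ψ i) (∑ i ∈ s, c i • Ψ i)).re =
            ∫ x, (star (u x) ⬝ᵥ (Q x *ᵥ u x)).re := by
          rw [potentialForm_apply]
          have : ∀ x, (∑ i ∈ s, c i • Ψ i) x = u x := fun x => funext fun a => hval s c x a
          simp only [this]
          exact (integral_re hUQ).symm
        rw [h5, ← hnorm s c, ← integral_finsetSum _ fun a _ => hui a, ← integral_const_mul,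
          ← integral_add hUQ' hρ]
        exact integral_mono hUW (hUQ'.add hρ) fun x => hWQ x (u x)
      have h6 : (μ + k ^ 2) * ∑ i ∈ s, ‖c i‖ ^ 2 ≤ ∑ i ∈ s, E i * ‖c i‖ ^ 2 := by
        rw [Finset.mul_sum]
        refine Finset.sum_le_sum fun i hi => mul_le_mul_of_nonneg_right ?_ (by positivity)
        have := (Real.le_sqrt hk.le (sub_pos.2 (hE i)).le).1 (hks i hi)
        linarith
      rw [Finset.sum_add_distrib, ← Finset.mul_sum, hnorm s c, hmain, h1]
      linarith)
  exact hsum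

section
open scoped Matrix.Norms.L2Operator

lemma continuous_matrix_cfc {n : ℕ} {W : ℝ → Matrix (Fin n) (Fin n) ℂ} (hWc : Continuous W)
    (hW : ∀ x, (W x).IsHermitian) {f : ℝ → ℝ} (hf : Continuous f) :
    Continuous fun x => cfc f (W x) :=
  hWc.cfc_of_mem_nhdsSet (s := Set.univ) f Filter.univ_mem (fun x => (hW x).isSelfAdjoint)
    hf.continuousOn

lemma norm_cfc_apply_le {n : ℕ} {A : Matrix (Fin n) (Fin n) ℂ} (hA : A.IsHermitian) (f : ℝ → ℝ)
    (a b : Fin n) : ‖cfc f A a b‖ ≤ ∑ i, |f (hA.eigenvalues i)| := by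
  rw [hA.cfc_eq, IsHermitian.cfc, Unitary.conjStarAlgAut_apply, mul_apply]
  refine (norm_sum_le _ _).trans (Finset.sum_le_sum fun i _ => ?_)
  have hU := hA.eigenvectorUnitary.2
  rw [mul_diagonal, norm_mul, norm_mul]
  have h1 := entry_norm_bound_of_unitary hU a i
  have h2 := entry_norm_bound_of_unitary (Unitary.star_mem hU) i b
  have h3 : ‖((RCLike.ofReal ∘ f ∘ hA.eigenvalues) i : ℂ)‖ = |f (hA.eigenvalues i)| := by simp
  rw [h3]
  calc _ ≤ 1 * |f (hA.eigenvalues i)| * 1 := by gcongr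
    _ = _ := by ring

end

lemma trace_cfc {n : ℕ} {A : Matrix (Fin n) (Fin n) ℂ} (hA : A.IsHermitian) (f : ℝ → ℝ) :
    (cfc f A).trace.re = ∑ i, f (hA.eigenvalues i) := by
  rw [hA.cfc_eq, IsHermitian.cfc, Unitary.conjStarAlgAut_apply, trace_mul_comm, ← mul_assoc,
    Unitary.coe_star_mul_self, one_mul, trace_diagonal]
  simp

lemma re_dotProduct_cfc_mulVec {n : ℕ} {A : Matrix (Fin n) (Fin n) ℂ} (hA : A.IsHermitian)
    (f : ℝ → ℝ) (v : Fin n → ℂ) :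
    (star v ⬝ᵥ (cfc f A *ᵥ v)).re = ∑ i, f (hA.eigenvalues i) *
      ‖((hA.eigenvectorUnitary : Matrix (Fin n) (Fin n) ℂ)ᴴ *ᵥ v) i‖ ^ 2 := by
  rw [hA.cfc_eq, IsHermitian.cfc, Unitary.conjStarAlgAut_apply, star_eq_conjTranspose, mul_assoc,
    ← mulVec_mulVec, ← mulVec_mulVec, dotProduct_mulVec,
    ← conjTranspose_conjTranspose (hA.eigenvectorUnitary : Matrix (Fin n) (Fin n) ℂ),
    ← star_mulVec, conjTranspose_conjTranspose]
  simp only [dotProduct, Pi.star_apply, mulVec_diagonal, Complex.re_sum]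
  refine Finset.sum_congr rfl fun i _ => ?_
  rw [mul_left_comm, ← starRingEnd_apply, Complex.conj_mul']
  refine (Complex.re_ofReal_mul _ _).trans ?_
  rw [← Complex.ofReal_pow, Complex.ofReal_re]
  rfl

lemma posSemidef_cfc {n : ℕ} {A : Matrix (Fin n) (Fin n) ℂ} (hA : A.IsHermitian) {f : ℝ → ℝ}
    (hf : ∀ t, 0 ≤ f t) : (cfc f A).PosSemidef := by
  rw [hA.cfc_eq, IsHermitian.cfc, Unitary.conjStarAlgAut_apply, star_eq_conjTranspose]
  refine PosSemidef.mul_mul_conjTranspose_same (posSemidef_diagonal_iff.2 fun i => ?_) _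
  simpa using hf _

lemma re_dotProduct_mulVec_le_cfc {n : ℕ} {A : Matrix (Fin n) (Fin n) ℂ} (hA : A.IsHermitian)
    (μ : ℝ) (v : Fin n → ℂ) :
    (star v ⬝ᵥ (A *ᵥ v)).re ≤
      (star v ⬝ᵥ (cfc (fun t => max (t - μ) 0) A *ᵥ v)).re + μ * ∑ a, ‖v a‖ ^ 2 := by
  have h1 : ∑ a, ‖v a‖ ^ 2 = (star v ⬝ᵥ (cfc (fun _ : ℝ => (1 : ℝ)) A *ᵥ v)).re := by
    rw [cfc_const_one ℝ A hA.isSelfAdjoint, one_mulVec]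
    simp only [dotProduct, Pi.star_apply, Complex.re_sum]
    refine Finset.sum_congr rfl fun i _ => ?_
    rw [← starRingEnd_apply, Complex.conj_mul']
    norm_cast
  have h2 : (star v ⬝ᵥ (A *ᵥ v)).re = (star v ⬝ᵥ (cfc (fun t : ℝ => t) A *ᵥ v)).re := by
    rw [cfc_id' ℝ A hA.isSelfAdjoint]
  rw [h1, h2, re_dotProduct_cfc_mulVec hA, re_dotProduct_cfc_mulVec hA,
    re_dotProduct_cfc_mulVec hA, Finset.mul_sum, ← Finset.sum_add_distrib]
  refine Finset.sum_le_sum fun i _ => ?_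
  rw [one_mul, ← add_mul]
  gcongr
  linarith [le_max_left (hA.eigenvalues i - μ) 0]

lemma continuous_sum_eigenvalues {n : ℕ} {W : ℝ → Matrix (Fin n) (Fin n) ℂ} (hWc : Continuous W)
    (hW : ∀ x, (W x).IsHermitian) {f : ℝ → ℝ} (hf : Continuous f) :
    Continuous fun x => ∑ i, f ((hW x).eigenvalues i) := by
  simp only [← trace_cfc]
  exact Complex.continuous_re.comp (continuous_matrix_cfc hWc hW hf).matrix_trace

/-- The Lieb–Thirring inequality for `γ = 1/2` in terms of the eigenvalues of the potential. -/
lemma sum_sqrt_le_integral_eigenvalues {n : ℕ} {ι : Type*} [Fintype ι] [DecidableEq ι]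
    {W : ℝ → Matrix (Fin n) (Fin n) ℂ} (hWc : Continuous W) (hW : ∀ x, (W x).PosSemidef)
    {μ : ℝ} (hμ : 0 ≤ μ) (hi : Integrable fun x => ∑ i, max ((hW x).1.eigenvalues i - μ) 0)
    {ψ ψ' ψ'' : ι → ℝ → Fin n → ℂ} (hψ : ∀ i x a, HasDerivAt (fun x => ψ i x a) (ψ' i x a) x)
    (hψ' : ∀ i x a, HasDerivAt (fun x => ψ' i x a) (ψ'' i x a) x)
    (hψi : ∀ i a, Integrable fun x => ‖ψ i x a‖ ^ 2) {E : ι → ℝ}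
    (heq : ∀ i x a, ψ'' i x a = -(W x *ᵥ ψ i x) a + E i * ψ i x a)
    (horth : ∀ i j, (∫ x, ∑ a, (starRingEnd ℂ) (ψ i x a) * ψ j x a) = if i = j then 1 else 0) :
    ∑ i, 2 * √(E i - μ) ≤ ∫ x, ∑ i, max ((hW x).1.eigenvalues i - μ) 0 := by
  have hf : Continuous fun t : ℝ => max (t - μ) 0 := by fun_prop
  have h := sum_sqrt_le_integral_trace (ι := {i // μ < E i}) hWc hW
    (Q := fun x => cfc (fun t => max (t - μ) 0) (W x))
    (fun x => posSemidef_cfc (hW x).1 fun t => le_max_right _ _)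
    (fun a b => by
      refine hi.mono' ?_ (.of_forall fun x => ?_)
      · exact (continuous_apply_apply a b |>.comp
          (continuous_matrix_cfc hWc (fun x => (hW x).1) hf)).aestronglyMeasurable
      · refine (norm_cfc_apply_le (hW x).1 _ a b).trans_eq ?_
        exact Finset.sum_congr rfl fun i _ => abs_of_nonneg (le_max_right _ _))
    hμ (fun x v => re_dotProduct_mulVec_le_cfc (hW x).1 μ v)
    (ψ := fun i => ψ i) (ψ' := fun i => ψ' i) (ψ'' := fun i => ψ'' i)
    (fun i => hψ i) (fun i => hψ' i) (fun i => hψi i) (E := fun i => E i) (fun i => i.2)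
    (fun i => heq i) (fun i j => by rw [horth]; simp [Subtype.ext_iff])
  simp only [trace_cfc (hW _).1] at h
  refine le_of_eq_of_le ?_ h
  rw [← Fintype.sum_subtype_add_sum_subtype (fun i => μ < E i), add_eq_left]
  refine Finset.sum_eq_zero fun i _ => ?_
  rw [Real.sqrt_eq_zero_of_nonpos (sub_nonpos.2 (not_lt.1 i.2)), mul_zero]

lemma lintegral_rpow_mul_max_sub_rpow {s p t : ℝ} (hs : 0 < s) (hp : 0 < p) (ht : 0 ≤ t) :
    ∫⁻ μ in Set.Ioi 0, ENNReal.ofReal (μ ^ (s - 1) * max (t - μ) 0 ^ p) =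
      ENNReal.ofReal (ProbabilityTheory.beta s (p + 1) * t ^ (s + p)) := by
  have h1 : ∫⁻ μ in Set.Ioi 0, ENNReal.ofReal (μ ^ (s - 1) * max (t - μ) 0 ^ p) =
      ∫⁻ μ in Set.Ioo 0 t, ENNReal.ofReal (μ ^ (s - 1) * max (t - μ) 0 ^ p) := by
    rw [← lintegral_indicator measurableSet_Ioi, ← lintegral_indicator measurableSet_Ioo]
    congr 1
    ext μ
    by_cases h0 : 0 < μ
    · by_cases h1 : μ < t
      · rw [Set.indicator_of_mem (show μ ∈ Set.Ioi 0 from h0),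
          Set.indicator_of_mem (show μ ∈ Set.Ioo 0 t from ⟨h0, h1⟩)]
      · rw [Set.indicator_of_mem (show μ ∈ Set.Ioi 0 from h0),
          Set.indicator_of_notMem (fun h => h1 h.2), max_eq_right (by linarith),
          Real.zero_rpow hp.ne', mul_zero, ENNReal.ofReal_zero]
    · rw [Set.indicator_of_notMem (show μ ∉ Set.Ioi 0 from h0),
        Set.indicator_of_notMem (show μ ∉ Set.Ioo 0 t from fun h => h0 h.1)]
  rw [h1]
  rcases ht.eq_or_lt with rfl | ht
  · simp [Real.zero_rpow (by positivity : s + p ≠ 0)]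
  have hb := ProbabilityTheory.beta_pos hs (by positivity : 0 < p + 1)
  have h2 : Set.Ioo 0 t = (fun x => t * x) '' Set.Ioo 0 1 := by
    rw [Set.image_mul_left_Ioo ht, mul_zero, mul_one]
  rw [h2, lintegral_image_eq_lintegral_abs_deriv_mul measurableSet_Ioo
    (f' := fun _ => t) (fun x _ => by simpa using ((hasDerivAt_id x).const_mul t).hasDerivWithinAt)
    (fun x _ y _ h => mul_left_cancel₀ ht.ne' h)]
  have h3 := ProbabilityTheory.lintegral_betaPDF_eq_one hs (by positivity : 0 < p + 1)
  rw [ProbabilityTheory.lintegral_betaPDF] at h3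
  rw [← mul_one (ENNReal.ofReal (_ * t ^ (s + p))), ← h3, ← lintegral_const_mul' _ _ (by simp)]
  refine setLIntegral_congr_fun measurableSet_Ioo fun x hx => ?_
  have hx0 := hx.1
  have hx1 : 0 < 1 - x := sub_pos.2 hx.2
  rw [← ENNReal.ofReal_mul (abs_nonneg _), ← ENNReal.ofReal_mul (by positivity), abs_of_pos ht,
    max_eq_left (by nlinarith), show t - t * x = t * (1 - x) by ring,
    Real.mul_rpow ht.le hx0.le, Real.mul_rpow ht.le hx1.le, add_sub_cancel_right,
    show s + p = 1 + (s - 1) + p by ring, Real.rpow_add ht, Real.rpow_add ht, Real.rpow_one]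
  congr 1
  field_simp

lemma beta_div_beta_eq {γ : ℝ} (hγ : 1 / 2 < γ) :
    ProbabilityTheory.beta (γ - 1 / 2) 2 / (2 * ProbabilityTheory.beta (γ - 1 / 2) (3 / 2)) =
      2 * Lcl γ 1 := by
  have h1 := (Real.Gamma_pos_of_pos (by linarith : 0 < γ - 1 / 2)).ne'
  have h2 := (Real.Gamma_pos_of_pos (by linarith : 0 < γ + 1)).ne'
  have h3 := (Real.Gamma_pos_of_pos (by linarith : 0 < γ + 3 / 2)).ne'
  have h4 : Real.Gamma (3 / 2) = √Real.pi / 2 := by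
    rw [show (3 / 2 : ℝ) = 1 / 2 + 1 by norm_num, Real.Gamma_add_one (by norm_num),
      Real.Gamma_one_half_eq]
    ring
  have h5 : (0 : ℝ) < √Real.pi := Real.sqrt_pos.2 Real.pi_pos
  unfold ProbabilityTheory.beta Lcl
  rw [show γ - 1 / 2 + 2 = γ + 3 / 2 by ring, show γ - 1 / 2 + 3 / 2 = γ + 1 by ring, h4,
    Real.Gamma_two, Nat.cast_one, show γ + 1 / 2 + 1 = γ + 3 / 2 by ring, ← Real.sqrt_eq_rpow]
  generalize Real.Gamma (γ - 1 / 2) = g at *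
  field_simp

lemma two_mul_Lcl_one_half : 2 * Lcl (1 / 2) 1 = 1 / 2 := by
  have h5 : (0 : ℝ) < √Real.pi := Real.sqrt_pos.2 Real.pi_pos
  unfold Lcl
  rw [Real.Gamma_add_one (by norm_num), Real.Gamma_one_half_eq, Nat.cast_one,
    show (1 / 2 + 1 / 2 + 1 : ℝ) = 2 by norm_num, Real.Gamma_two, ← Real.sqrt_eq_rpow]
  field_simp

/-- The argument of Aizenman and Lieb: a bound on the sums `∑ √(E j - μ)` for all `μ > 0` implies
a bound on the moments of order `γ > 1/2`. -/
lemma sum_rpow_le_of_forall_sum_sqrt_le {n : ℕ} {ι : Type*} [Fintype ι] {w : ℝ → Fin n → ℝ}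
    (hw0 : ∀ x i, 0 ≤ w x i) (hwc : ∀ μ, Continuous fun x => ∑ i, max (w x i - μ) 0) {γ : ℝ}
    (hγ : 1 / 2 < γ) (hi : Integrable fun x => ∑ i, w x i ^ (γ + 1 / 2)) {E : ι → ℝ}
    (hE : ∀ j, 0 ≤ E j)
    (h : ∀ μ, 0 < μ → Integrable (fun x => ∑ i, max (w x i - μ) 0) →
      ∑ j, 2 * √(E j - μ) ≤ ∫ x, ∑ i, max (w x i - μ) 0) :
    ∑ j, E j ^ γ ≤ 2 * Lcl γ 1 * ∫ x, ∑ i, w x i ^ (γ + 1 / 2) := by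
  have hs : 0 < γ - 1 / 2 := sub_pos.2 hγ
  have h_int : ∀ μ, 0 < μ → Integrable (fun x => ∑ i, max (w x i - μ) 0) := by
    intro μ hμ
    refine (hi.const_mul (μ ^ (γ - 1 / 2))⁻¹).mono' (hwc μ).aestronglyMeasurable
      (.of_forall fun x => ?_)
    rw [Real.norm_of_nonneg (Finset.sum_nonneg fun i _ => le_max_right _ _), Finset.mul_sum]
    refine Finset.sum_le_sum fun i _ => max_le ?_ ?_
    · rcases le_or_gt (w x i) μ with hle | hlt
      · have := hw0 x i
        exact (sub_nonpos.2 hle).trans (by positivity)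
      · have hw : 0 < w x i := hμ.trans hlt
        have h1 : μ ^ (γ - 1 / 2) ≤ w x i ^ (γ - 1 / 2) := Real.rpow_le_rpow hμ.le hlt.le hs.le
        have h2 : w x i ^ (γ + 1 / 2) = w x i ^ (γ - 1 / 2) * w x i := by
          rw [show γ + 1 / 2 = γ - 1 / 2 + 1 by ring, Real.rpow_add hw, Real.rpow_one]
        rw [h2, inv_mul_eq_div, le_div_iff₀ (by positivity), mul_comm]
        exact mul_le_mul h1 (by linarith) (by linarith) (by positivity)
    · have := hw0 x i
      positivity
  have hsqrt : ∀ μ t : ℝ, √(t - μ) = max (t - μ) 0 ^ (1 / 2 : ℝ) := by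
    intro μ t
    rw [← Real.sqrt_eq_rpow]
    rcases le_total 0 (t - μ) with h0 | h0
    · rw [max_eq_left h0]
    · rw [max_eq_right h0, Real.sqrt_zero, Real.sqrt_eq_zero_of_nonpos h0]
  have hleft : ∫⁻ μ in Set.Ioi 0, ENNReal.ofReal (μ ^ (γ - 1 / 2 - 1) * ∑ j, 2 * √(E j - μ)) =
      ENNReal.ofReal (2 * ProbabilityTheory.beta (γ - 1 / 2) (3 / 2) * ∑ j, E j ^ γ) := by
    have h1 : ∀ μ ∈ Set.Ioi (0 : ℝ),
        ENNReal.ofReal (μ ^ (γ - 1 / 2 - 1) * ∑ j, 2 * √(E j - μ)) =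
        ∑ j, ENNReal.ofReal 2 *
          ENNReal.ofReal (μ ^ (γ - 1 / 2 - 1) * max (E j - μ) 0 ^ (1 / 2 : ℝ)) := by
      intro μ hμ
      have hμ0 : 0 < μ := hμ
      rw [Finset.mul_sum, ENNReal.ofReal_sum_of_nonneg fun j _ => by positivity]
      refine Finset.sum_congr rfl fun j _ => ?_
      rw [← ENNReal.ofReal_mul zero_le_two, hsqrt, mul_left_comm]
    have hb : 0 < ProbabilityTheory.beta (γ - 1 / 2) (3 / 2) :=
      ProbabilityTheory.beta_pos hs (by norm_num)
    rw [setLIntegral_congr_fun measurableSet_Ioi h1,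
      lintegral_finsetSum' _ fun j _ => by fun_prop]
    rw [Finset.mul_sum, ENNReal.ofReal_sum_of_nonneg fun j _ => by have := hE j; positivity]
    refine Finset.sum_congr rfl fun j _ => ?_
    rw [lintegral_const_mul' _ _ (by simp),
      lintegral_rpow_mul_max_sub_rpow hs (by norm_num) (hE j), ← ENNReal.ofReal_mul zero_le_two,
      sub_add_cancel, ← mul_assoc]
    norm_num
  have hright : ∫⁻ μ in Set.Ioi 0, ∫⁻ x,
      ENNReal.ofReal (μ ^ (γ - 1 / 2 - 1) * ∑ i, max (w x i - μ) 0) =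
      ENNReal.ofReal (ProbabilityTheory.beta (γ - 1 / 2) 2 * ∫ x, ∑ i, w x i ^ (γ + 1 / 2)) := by
    have hmeas : Measurable (Function.uncurry fun x μ => ∑ i, max (w x i - μ) 0) :=
      measurable_uncurry_of_continuous_of_measurable hwc fun x => by fun_prop
    have hmeas' : Measurable fun z : ℝ × ℝ => ∑ i, max (w z.2 i - z.1) 0 :=
      hmeas.comp measurable_swap
    have hb : 0 < ProbabilityTheory.beta (γ - 1 / 2) 2 := ProbabilityTheory.beta_pos hs two_pos
    rw [lintegral_lintegral_swap]
    · rw [← integral_const_mul, ofReal_integral_eq_lintegral_ofReal (hi.const_mul _)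
        (.of_forall fun x => by
          have := hw0 x
          simp only [Pi.zero_apply]
          exact mul_nonneg hb.le (Finset.sum_nonneg fun i _ => Real.rpow_nonneg (hw0 x i) _))]
      refine lintegral_congr fun x => ?_
      have h1 : ∀ μ ∈ Set.Ioi (0 : ℝ),
          ENNReal.ofReal (μ ^ (γ - 1 / 2 - 1) * ∑ i, max (w x i - μ) 0) =
          ∑ i, ENNReal.ofReal (μ ^ (γ - 1 / 2 - 1) * max (w x i - μ) 0 ^ (1 : ℝ)) := by
        intro μ hμ
        have hμ0 : 0 < μ := hμ
        simp only [Real.rpow_one]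
        rw [Finset.mul_sum, ENNReal.ofReal_sum_of_nonneg fun i _ => by positivity]
      rw [setLIntegral_congr_fun measurableSet_Ioi h1,
        lintegral_finsetSum' _ fun j _ => by fun_prop, Finset.mul_sum,
        ENNReal.ofReal_sum_of_nonneg fun i _ => by have := hw0 x i; positivity]
      refine Finset.sum_congr rfl fun i _ => ?_
      rw [lintegral_rpow_mul_max_sub_rpow hs one_pos (hw0 x i), one_add_one_eq_two,
        show γ - 1 / 2 + 1 = γ + 1 / 2 by ring]
    · refine Measurable.aemeasurable (Measurable.ennreal_ofReal ?_)
      exact (measurable_fst.pow_const _).mul hmeas'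
  have hle : ∫⁻ μ in Set.Ioi 0, ENNReal.ofReal (μ ^ (γ - 1 / 2 - 1) * ∑ j, 2 * √(E j - μ)) ≤
      ∫⁻ μ in Set.Ioi 0, ∫⁻ x,
        ENNReal.ofReal (μ ^ (γ - 1 / 2 - 1) * ∑ i, max (w x i - μ) 0) := by
    refine setLIntegral_mono' measurableSet_Ioi fun μ hμ => ?_
    have hμ0 : 0 < μ := hμ
    rw [← ofReal_integral_eq_lintegral_ofReal ((h_int μ hμ).const_mul _)
      (.of_forall fun x => by
        simp only [Pi.zero_apply]
        positivity), integral_const_mul]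
    exact ENNReal.ofReal_le_ofReal (mul_le_mul_of_nonneg_left (h μ hμ (h_int μ hμ)) (by positivity))
  have hb := ProbabilityTheory.beta_pos hs (by norm_num : (0 : ℝ) < 3 / 2)
  have hb2 := ProbabilityTheory.beta_pos hs two_pos
  have hI : 0 ≤ ∫ x, ∑ i, w x i ^ (γ + 1 / 2) := integral_nonneg fun x =>
    Finset.sum_nonneg fun i _ => Real.rpow_nonneg (hw0 x i) _
  rw [hleft, hright, ENNReal.ofReal_le_ofReal_iff (by positivity)] at hle
  rw [← beta_div_beta_eq hγ, div_mul_eq_mul_div, le_div_iff₀ (by positivity), mul_comm]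
  exact hle

/-- **Lieb–Thirring bound for moments `γ ≥ 1/2` in dimension one, matrix potentials:**
`∑ E_j^γ ≤ 2 L^cl_{γ,1} ∫ tr((-V)^{γ+1/2}) dx`. -/
theorem lieb_thirring_moments_one_dim_matrix (γ : ℝ) (hγ : 1 / 2 ≤ γ)
    (n : ℕ) (hn : 1 ≤ n)
    (V : ℝ → Matrix (Fin n) (Fin n) ℂ)
    (hVcont : Continuous V)
    (hV : ∀ x, (-(V x)).PosSemidef)
    (hVint : Integrable fun x => traceRpow (-(V x)) (hV x).1 (γ + 1 / 2))
    (N : ℕ) (ψ : Fin N → ℝ → Fin n → ℂ) (E : Fin N → ℝ)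
    (hE : ∀ j, 0 < E j)
    (hψC2 : ∀ j i, ContDiff ℝ 2 fun x => ψ j x i)
    (hψL2 : ∀ j, Integrable fun x => ∑ i, Complex.normSq (ψ j x i))
    (horth : ∀ j l, (∫ x : ℝ, ∑ i, (starRingEnd ℂ) (ψ j x i) * ψ l x i)
      = if j = l then 1 else 0)
    (heq : ∀ j x i,
      -(deriv (fun y => deriv (fun z => ψ j z i) y) x) + (V x *ᵥ ψ j x) i
        = -(E j : ℂ) * ψ j x i) :
    ∑ j, E j ^ γ ≤
      2 * Lcl γ 1 * ∫ x : ℝ, traceRpow (-(V x)) (hV x).1 (γ + 1 / 2) := by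
  have hsum : ∀ μ, 0 ≤ μ →
      Integrable (fun x => ∑ i, max ((hV x).1.eigenvalues i - μ) 0) →
      ∑ j, 2 * √(E j - μ) ≤ ∫ x, ∑ i, max ((hV x).1.eigenvalues i - μ) 0 := by
    intro μ hμ hi
    refine sum_sqrt_le_integral_eigenvalues (W := fun x => -(V x)) hVcont.neg hV hμ hi (ψ := ψ)
      (ψ' := fun j x i => deriv (fun z => ψ j z i) x)
      (ψ'' := fun j x i => deriv (fun y => deriv (fun z => ψ j z i) y) x)
      (fun j x i => ((hψC2 j i).differentiable two_ne_zero x).hasDerivAt)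
      (fun j x i => ((hψC2 j i).differentiable_deriv_two x).hasDerivAt)
      (fun j i => (hψL2 j).mono' ((hψC2 j i).continuous.norm.pow 2).aestronglyMeasurable
        (.of_forall fun x => ?_)) (fun j x i => ?_) horth
    · rw [Real.norm_of_nonneg (sq_nonneg _), ← Complex.normSq_eq_norm_sq]
      exact Finset.single_le_sum (f := fun i => Complex.normSq (ψ j x i))
        (fun i _ => Complex.normSq_nonneg _) (Finset.mem_univ i)
    · rw [neg_mulVec, Pi.neg_apply]
      linear_combination -heq j x i
  rcases hγ.eq_or_lt with rfl | hγ
  · have h1 : ∀ x, ∑ i, max ((hV x).1.eigenvalues i - 0) 0 =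
        traceRpow (-(V x)) (hV x).1 (1 / 2 + 1 / 2) := fun x =>
      Finset.sum_congr rfl fun i _ => by
        rw [sub_zero, max_eq_left ((hV x).eigenvalues_nonneg i), add_halves, Real.rpow_one]
    have h2 := hsum 0 le_rfl (by simpa only [h1] using hVint)
    simp only [h1] at h2
    rw [two_mul_Lcl_one_half]
    simp only [sub_zero, ← Finset.mul_sum, Real.sqrt_eq_rpow] at h2
    linarith
  · exact sum_rpow_le_of_forall_sum_sqrt_le (fun x i => (hV x).eigenvalues_nonneg i)
      (fun μ => continuous_sum_eigenvalues hVcont.neg (fun x => (hV x).1)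
        (f := fun t => max (t - μ) 0) (by fun_prop))
      hγ hVint (fun j => (hE j).le) fun μ hμ hi => hsum μ hμ.le hi
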